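/- arXiv:math/0203203 — 2 statements merged into one kernel-verified Lean document; each statement's English description precedes it below -/
import Mathlib

section
/- Let A ⊆ ℝP^n be an L-convex-concave set with dim L = n − 2. Then for any four hyperplanes N₁, N₂, N₃, N₄ of ℝP^n containing L, there exists a projective line in ℝP^n intersecting each of the four sections A ∩ N₁, A ∩ N₂, A ∩ N₃, A ∩ N₄. -/
open Module Set Pointwise

noncomputable section

namespace CC

/-- The underlying vector space of `ℝPⁿ`. -/
abbrev Vec (n : ℕ) : Type := Fin (n + 1) → ℝ

/-- Real projective `n`-space `ℝPⁿ = ℙ(ℝ^{n+1})`. -/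
abbrev Pt (n : ℕ) : Type := Projectivization ℝ (Vec n)

/-- The dual projective space `(ℝPⁿ)*`, whose points are the hyperplanes of `ℝPⁿ`. -/
abbrev DPt (n : ℕ) : Type := Projectivization ℝ (Module.Dual ℝ (Vec n))

/-- The quotient topology on a projectivization. -/
instance projTop {K V : Type*} [DivisionRing K] [AddCommGroup V] [Module K V]
    [TopologicalSpace V] : TopologicalSpace (Projectivization K V) :=
  instTopologicalSpaceQuotient

/-- The canonical topology on the dual of `ℝ^{n+1}` (transported through any linear
coordinate system; all bases induce the same topology). -/
instance dualTop (n : ℕ) : TopologicalSpace (Module.Dual ℝ (Vec n)) :=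
  TopologicalSpace.induced (Module.finBasis ℝ (Module.Dual ℝ (Vec n))).equivFun inferInstance

variable {M : Type*} [AddCommGroup M] [Module ℝ M]

/-- The point `x ∈ ℙ(M)` lies on the hyperplane corresponding to the point `π` of the
dual projective space `ℙ(M*)` (i.e. `x` is in the projectivization of the kernel of any
functional representing `π`). -/
def Incident (π : Projectivization ℝ (Module.Dual ℝ M)) (x : Projectivization ℝ M) : Prop :=
  π.rep x.rep = 0

/-- The projectively dual set `S*_p ⊆ P*`: the set of all hyperplanes of `P`
disjoint from `S`. -/
def dualSet (A : Set (Projectivization ℝ M)) : Set (Projectivization ℝ (Module.Dual ℝ M)) :=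
  {π | ∀ x ∈ A, ¬Incident π x}

/-- Projective separability: every point of the complement of `S` lies on a hyperplane
disjoint from `S`. -/
def ProjSeparable (A : Set (Projectivization ℝ M)) : Prop :=
  ∀ x ∉ A, ∃ π : Projectivization ℝ (Module.Dual ℝ M), Incident π x ∧ ∀ y ∈ A, ¬Incident π y

/-- The projective subspace of `ℙ(M)` associated to a linear subspace `W ≤ M`. -/
def projSet (W : Submodule ℝ M) : Set (Projectivization ℝ M) :=
  {x | x.rep ∈ W}

/-- The canonical identification `ℙ(M) → ℙ(M**)` induced by the canonical isomorphism
`M ≃ M**`. -/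
def toDoubleDual [FiniteDimensional ℝ M] :
    Projectivization ℝ M → Projectivization ℝ (Module.Dual ℝ (Module.Dual ℝ M)) :=
  Projectivization.map (Module.evalEquiv ℝ M).toLinearMap (Module.evalEquiv ℝ M).injective

/-- The `L`-dual set `A^⊥_L ⊆ ℙ(M*)` of a set `A ⊆ ℙ(M)` (for `L = ℙ(W)`): the set of
all hyperplanes `π` of `ℙ(M)` meeting every section `A ∩ N` by a projective subspace
`N ⊇ L` with `dim N = dim L + 1`. -/
def LdualSet (W : Submodule ℝ M) (A : Set (Projectivization ℝ M)) :
    Set (Projectivization ℝ (Module.Dual ℝ M)) :=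
  {π | ∀ N : Submodule ℝ M, W ≤ N → finrank ℝ N = finrank ℝ W + 1 →
    ∃ x ∈ A, Incident π x ∧ x.rep ∈ N}

/-- `(A^⊥_L)^⊥_{L*}`, brought back from `ℙ(M**)` to `ℙ(M)` via the canonical
identification `M ≅ M**`. -/
def Lbidual [FiniteDimensional ℝ M] (W : Submodule ℝ M) (A : Set (Projectivization ℝ M)) :
    Set (Projectivization ℝ M) :=
  toDoubleDual ⁻¹' LdualSet W.dualAnnihilator (LdualSet W A)

/-- The image of a set `A ⊆ ℙ(M)` under the projection from the center `ℙ(W)`: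
`y` is in the image iff some point `x ∈ A` not in the center projects to `y`
(i.e. the class of a representing vector of `x` spans the line `y`). -/
def projImage (W : Submodule ℝ M) (A : Set (Projectivization ℝ M)) :
    Set (Projectivization ℝ (M ⧸ W)) :=
  {y | ∃ x ∈ A, x.rep ∉ W ∧ W.mkQ x.rep ∈ y.submodule}

/-- The coordinate, in the affine chart of `ℙ(M)` given by a functional `φ`
(the complement of the hyperplane `ℙ(ker φ)`, identified with `{v | φ v = 1}`),
of a point `x` with `φ x.rep ≠ 0`. -/
def projChart (φ : Module.Dual ℝ M) (x : Projectivization ℝ M) : M :=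
  (φ x.rep)⁻¹ • x.rep

/-- A convex subset of a projective space: a set disjoint from some hyperplane and
convex in the corresponding affine chart. -/
def IsProjConvex (A : Set (Projectivization ℝ M)) : Prop :=
  ∃ φ : Module.Dual ℝ M, φ ≠ 0 ∧ (∀ x ∈ A, φ x.rep ≠ 0) ∧ Convex ℝ (projChart φ '' A)

/-- `L`-convex-concavity of a closed set `A ⊆ ℙ(M)` with respect to the projective
subspace `L = ℙ(W)`: `A` is closed, disjoint from `L`, all sections of `A` by
projective subspaces `N ⊇ L` with `dim N = dim L + 1` are nonempty and convex, and the
complement of the projection of `A` from any center `T ⊂ L` with `dim T = dim L − 1`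
is open and convex. -/
def IsLConvexConcave [TopologicalSpace M] (W : Submodule ℝ M)
    (A : Set (Projectivization ℝ M)) : Prop :=
  IsClosed A ∧ (∀ x ∈ A, x.rep ∉ W) ∧
    (∀ N : Submodule ℝ M, W ≤ N → finrank ℝ N = finrank ℝ W + 1 →
      (A ∩ projSet N).Nonempty ∧ IsProjConvex (A ∩ projSet N)) ∧
    (∀ T : Submodule ℝ M, T ≤ W → finrank ℝ T + 1 = finrank ℝ W →
      IsOpen (projImage T A)ᶜ ∧ IsProjConvex (projImage T A)ᶜ)

/-- The lift of a hyperplane `π` of `ℙ(M)` containing the center `ℙ(Q)` to a hyperplane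
of the quotient projective space `ℙ(M ⧸ Q)`. -/
def liftHyperplane (Q : Submodule ℝ M) (π : Projectivization ℝ (Module.Dual ℝ M))
    (h : ∀ v ∈ Q, π.rep v = 0) : Projectivization ℝ (Module.Dual ℝ (M ⧸ Q)) :=
  Projectivization.mk ℝ (Q.liftQ π.rep fun v hv => LinearMap.mem_ker.mpr (h v hv))
    (fun hz => π.rep_nonzero (by
      have h2 := Submodule.liftQ_mkQ Q π.rep (fun v hv => LinearMap.mem_ker.mpr (h v hv))
      rw [hz] at h2
      simpa using h2.symm))

/-- Affine separability of a set `B`, inside the affine chart of `ℙ(M)` given by a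
functional `φ`: every point of the chart outside `B` lies in a closed half-space of the
chart (cut out by an affine function which is nonconstant on the chart) disjoint
from `B`.  A closed half-space of the chart `{v | φ v = 1}` is cut out by a functional
`g` (nonproportional to `φ`, so that `g` is nonconstant on the chart) via the
scale-invariant condition `g(x)/φ(x) ≥ 0`. -/
def AffSepInChart (φ : Module.Dual ℝ M) (B : Set (Projectivization ℝ M)) : Prop :=
  ∀ y : Projectivization ℝ M, φ y.rep ≠ 0 → y ∉ B →
    ∃ g : Module.Dual ℝ M, (∀ c : ℝ, g ≠ c • φ) ∧ 0 ≤ g y.rep / φ y.rep ∧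
      ∀ z ∈ B, g z.rep / φ z.rep < 0

/-- `A` is coseparable relative to `L = ℙ(W)`: `A` is disjoint from `L`, and for every
hyperplane `L₁` of `L`, the complement of the projection of `A` from the center `L₁`
misses some hyperplane of `ℝPⁿ/L₁` and is affinely separable in the corresponding
affine chart. -/
def Coseparable (W : Submodule ℝ M) (A : Set (Projectivization ℝ M)) : Prop :=
  (∀ x ∈ A, x.rep ∉ W) ∧
    ∀ W₁ : Submodule ℝ M, W₁ ≤ W → finrank ℝ W₁ + 1 = finrank ℝ W →
      ∃ φ : Module.Dual ℝ (M ⧸ W₁), φ ≠ 0 ∧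
        (∀ y ∈ (projImage W₁ A)ᶜ, φ y.rep ≠ 0) ∧
        AffSepInChart φ (projImage W₁ A)ᶜ

/-- A set `S` contained in the projective subspace `N = ℙ(Nsub)`, disjoint from the
hyperplane `L = ℙ(W)` of `N`, is pointed with respect to `Δ ⊆ L` if it has two vertices
`a, b ∈ S` such that a hyperplane `p` of `N` disjoint from `Δ` meets `S` iff it meets
the straight segment joining `a` and `b` in the affine chart `N ∖ L` (the chart being
given by any functional vanishing on `W` and nonzero at `a` and `b`). -/
def PointedWrt (W Nsub : Submodule ℝ M) (Δ S : Set (Projectivization ℝ M)) : Prop :=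
  ∃ a ∈ S, ∃ b ∈ S,
    ∀ P : Submodule ℝ M, P ≤ Nsub → finrank ℝ P + 1 = finrank ℝ Nsub →
      (∀ x ∈ Δ, x.rep ∉ P) →
      ((∃ x ∈ S, x.rep ∈ P) ↔
        ∀ φ : Module.Dual ℝ M, (∀ w ∈ W, φ w = 0) → φ a.rep ≠ 0 → φ b.rep ≠ 0 →
          ∃ t ∈ Icc (0 : ℝ) 1,
            t • ((φ a.rep)⁻¹ • a.rep) + (1 - t) • ((φ b.rep)⁻¹ • b.rep) ∈ P)

/-- The hyperplane `Γ_c` of `ℙ(M)` containing the center `ℙ(W)` and corresponding to the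
point `c` of `ℙ(M ⧸ W)`. -/
def gammaSet (W : Submodule ℝ M) (c : Projectivization ℝ (M ⧸ W)) :
    Set (Projectivization ℝ M) :=
  {x | W.mkQ x.rep ∈ c.submodule}

/-- The surgery `S_{[a,b]}(A)` of a set `A ⊆ ℙ(M)` along the arc `Arc = [a,b]` of the
projective line `ℙ(M ⧸ W)`, computed in the affine chart given by a functional `φ`
whose kernel is the cone of the hyperplane `Γ_c` (for a point `c ∉ Arc`): points
projecting into `Arc` are replaced by the convex hull of `(A ∩ Γ_a) ∪ (A ∩ Γ_b)` taken
in the chart, points projecting outside `Arc` are kept iff they belong to `A`, and the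
result is disjoint from `ℙ(W)`. -/
def surgery (W : Submodule ℝ M) (a b : Projectivization ℝ (M ⧸ W))
    (Arc : Set (Projectivization ℝ (M ⧸ W))) (φ : Module.Dual ℝ M)
    (A : Set (Projectivization ℝ M)) : Set (Projectivization ℝ M) :=
  {x | x.rep ∉ W ∧
    ((∃ y ∈ Arc, W.mkQ x.rep ∈ y.submodule) →
      φ x.rep ≠ 0 ∧
        projChart φ x ∈ convexHull ℝ (projChart φ '' (A ∩ (gammaSet W a ∪ gammaSet W b)))) ∧
    ((¬∃ y ∈ Arc, W.mkQ x.rep ∈ y.submodule) → x ∈ A)}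

/-- The linear map `M* ⧸ T → Q*` (for `Q = ℙ(T)*`-perp, i.e. `Q = T.dualCoannihilator`)
realizing the canonical identification of `(ℝPⁿ)*/T` with the space of hyperplanes of
the projective space `ℙ(Q)`: the class of a hyperplane `π ⊅ Q` of `ℝPⁿ` corresponds to
the hyperplane `π ∩ ℙ(Q)` of `ℙ(Q)`. -/
def restrictToSub (T : Submodule ℝ (Module.Dual ℝ M)) :
    (Module.Dual ℝ M ⧸ T) →ₗ[ℝ] Module.Dual ℝ T.dualCoannihilator :=
  T.liftQ (T.dualCoannihilator.subtype.dualMap)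
    (fun φ hφ => LinearMap.mem_ker.mpr
      (LinearMap.ext fun q => (Submodule.mem_dualCoannihilator _).mp q.2 φ hφ))

/-- The punctured cone over a subset of a projective space. -/
def Co {M : Type*} [AddCommGroup M] [Module ℝ M] (B : Set (Projectivization ℝ M)) : Set M :=
  {v | ∃ h : v ≠ 0, Projectivization.mk ℝ v h ∈ B}

theorem Co.smul {M : Type*} [AddCommGroup M] [Module ℝ M] {B : Set (Projectivization ℝ M)}
    {v : M} (hv : v ∈ Co B) {c : ℝ} (hc : c ≠ 0) : c • v ∈ Co B := by
  obtain ⟨h, hB⟩ := hv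
  refine ⟨smul_ne_zero hc h, ?_⟩
  have : Projectivization.mk ℝ (c • v) (smul_ne_zero hc h) = Projectivization.mk ℝ v h := by
    rw [Projectivization.mk_eq_mk_iff']
    exact ⟨c, rfl⟩
  rw [this]; exact hB

theorem Co.rep {M : Type*} [AddCommGroup M] [Module ℝ M] {B : Set (Projectivization ℝ M)}
    {x : Projectivization ℝ M} (hx : x ∈ B) : x.rep ∈ Co B :=
  ⟨x.rep_nonzero, by rw [Projectivization.mk_rep]; exact hx⟩

theorem Co.exists_rep {M : Type*} [AddCommGroup M] [Module ℝ M] {B : Set (Projectivization ℝ M)}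
    {v : M} (hv : v ∈ Co B) : ∃ x ∈ B, ∃ c : ℝ, c ≠ 0 ∧ x.rep = c • v := by
  obtain ⟨h, hB⟩ := hv
  refine ⟨_, hB, ?_⟩
  obtain ⟨a, ha⟩ := Projectivization.exists_smul_eq_mk_rep ℝ v h
  exact ⟨a, a.ne_zero, ha.symm⟩

theorem Co.convex {M : Type*} [AddCommGroup M] [Module ℝ M] {B : Set (Projectivization ℝ M)}
    {φ : Module.Dual ℝ M} (hne : ∀ x ∈ B, φ x.rep ≠ 0) (hc : Convex ℝ (projChart φ '' B))
    {a b : M} (ha : a ∈ Co B) (hb : b ∈ Co B) {s t : ℝ}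
    (hs : 0 ≤ s * φ a) (ht : 0 ≤ t * φ b) (hst : 0 < s * φ a + t * φ b) :
    s • a + t • b ∈ Co B := by
  have key : ∀ v ∈ Co B, φ v ≠ 0 ∧ (φ v)⁻¹ • v ∈ projChart φ '' B := by
    intro v hv
    obtain ⟨x, hx, c, hc0, hr⟩ := Co.exists_rep hv
    have h1 := hne x hx
    rw [hr, map_smul, smul_eq_mul] at h1
    have h2 : φ v ≠ 0 := right_ne_zero_of_mul h1
    refine ⟨h2, x, hx, ?_⟩
    unfold projChart
    rw [hr, map_smul, smul_smul, smul_eq_mul]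
    congr 1
    field_simp
  obtain ⟨ha0, ha1⟩ := key a ha
  obtain ⟨hb0, hb1⟩ := key b hb
  set r := s * φ a + t * φ b with hr
  have h := hc ha1 hb1 (a := s * φ a / r) (b := t * φ b / r) (by positivity) (by positivity)
    (by rw [← add_div, ← hr]; exact div_self hst.ne')
  have e : (s * φ a / r) • (φ a)⁻¹ • a + (t * φ b / r) • (φ b)⁻¹ • b = r⁻¹ • (s • a + t • b) := by
    rw [smul_add, smul_smul, smul_smul, smul_smul, smul_smul]
    congr 2 <;> field_simp
  rw [e] at h
  obtain ⟨x, hx, hxe⟩ := h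
  have h3 := Co.smul (Co.rep hx) (inv_ne_zero (hne x hx))
  unfold projChart at hxe
  rw [hxe] at h3
  have h4 := Co.smul h3 hst.ne'
  rwa [smul_smul, mul_inv_cancel₀ hst.ne', one_smul] at h4

theorem Co.compl_of {M : Type*} [AddCommGroup M] [Module ℝ M] {A : Set (Projectivization ℝ M)}
    (T : Submodule ℝ M) {v : M} (hv : v ∉ T) (h : ∀ y ∈ Co A, y - v ∉ T) :
    T.mkQ v ∈ Co (projImage T A)ᶜ := by
  have h0 : T.mkQ v ≠ 0 := by simpa using hv
  refine ⟨h0, ?_⟩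
  rintro ⟨x, hx, hxT, hm⟩
  rw [Projectivization.submodule_mk, Submodule.mem_span_singleton] at hm
  obtain ⟨c, hc⟩ := hm
  have hc0 : c ≠ 0 := by
    rintro rfl
    apply hxT
    simpa using hc.symm
  refine h _ (Co.smul (Co.rep hx) (inv_ne_zero hc0)) ?_
  rw [← Submodule.ker_mkQ T, LinearMap.mem_ker, map_sub, map_smul, ← hc, smul_smul,
    inv_mul_cancel₀ hc0, one_smul, sub_self]

theorem Co.not_compl {M : Type*} [AddCommGroup M] [Module ℝ M] {A : Set (Projectivization ℝ M)}
    (T : Submodule ℝ M) {v : M} (hv : v ∈ Co A) (hT : v ∉ T) :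
    T.mkQ v ∉ Co (projImage T A)ᶜ := by
  rintro ⟨h0, h⟩
  apply h
  obtain ⟨x, hx, c, hc0, hr⟩ := Co.exists_rep hv
  refine ⟨x, hx, ?_, ?_⟩
  · rw [hr]
    rwa [Submodule.smul_mem_iff _ hc0]
  · rw [Projectivization.submodule_mk, Submodule.mem_span_singleton, hr]
    exact ⟨c, by simp⟩

/-- The normalized section of the cone over `A` by the coset of `e`. -/
def Sec {M : Type*} [AddCommGroup M] [Module ℝ M] (W : Submodule ℝ M)
    (A : Set (Projectivization ℝ M)) (e : M) : Set M :=
  {v | v ∈ Co A ∧ v - e ∈ W}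

section
variable {n : ℕ} {W : Submodule ℝ (Vec n)} {A : Set (Pt n)}

theorem not_mem_W (hA : IsLConvexConcave W A) {v : Vec n} (hv : v ∈ Co A) : v ∉ W := by
  obtain ⟨x, hx, c, hc0, hr⟩ := Co.exists_rep hv
  have := hA.2.1 x hx
  rwa [hr, Submodule.smul_mem_iff _ hc0] at this

theorem finrank_sup_span (W : Submodule ℝ (Vec n)) {e : Vec n} (he : e ∉ W) :
    finrank ℝ (W ⊔ Submodule.span ℝ {e} : Submodule ℝ (Vec n)) = finrank ℝ W + 1 := by
  have h := Submodule.finrank_sup_add_finrank_inf_eq W (Submodule.span ℝ {e})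
  have h1 : W ⊓ Submodule.span ℝ {e} = ⊥ := by
    rw [← disjoint_iff, Submodule.disjoint_span_singleton' (by rintro rfl; exact he W.zero_mem)]
    exact he
  have h2 : finrank ℝ (Submodule.span ℝ {e}) = 1 :=
    finrank_span_singleton (by rintro rfl; exact he W.zero_mem)
  rw [h1, h2, finrank_bot] at h
  omega

theorem Sec.smul {e v : Vec n} (hv : v ∈ Sec W A e) {c : ℝ} (hc : c ≠ 0) :
    c • v ∈ Sec W A (c • e) :=
  ⟨Co.smul hv.1 hc, by rw [← smul_sub]; exact W.smul_mem c hv.2⟩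

theorem Sec.congr {e e' v : Vec n} (hv : v ∈ Sec W A e) (h : e - e' ∈ W) : v ∈ Sec W A e' :=
  ⟨hv.1, by have := W.add_mem hv.2 h; simpa using this⟩

theorem Sec.nonempty (hA : IsLConvexConcave W A) {e : Vec n} (he : e ∉ W) :
    (Sec W A e).Nonempty := by
  obtain ⟨⟨x, hx, hxN⟩, -⟩ :=
    hA.2.2.1 (W ⊔ Submodule.span ℝ {e}) le_sup_left (finrank_sup_span W he)
  have hxW := hA.2.1 x hx
  change x.rep ∈ W ⊔ Submodule.span ℝ {e} at hxN
  obtain ⟨w, hw, z, hz, hs⟩ := Submodule.mem_sup.1 hxN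
  obtain ⟨c, rfl⟩ := Submodule.mem_span_singleton.1 hz
  have hc : c ≠ 0 := by
    rintro rfl
    apply hxW
    rw [← hs]; simpa using hw
  refine ⟨c⁻¹ • x.rep, Co.smul (Co.rep hx) (inv_ne_zero hc), ?_⟩
  rw [← hs, smul_add, smul_smul, inv_mul_cancel₀ hc, one_smul, add_sub_cancel_right]
  exact W.smul_mem _ hw

theorem Sec.convex (hA : IsLConvexConcave W A) {e : Vec n} (he : e ∉ W) :
    Convex ℝ (Sec W A e) := by
  obtain ⟨-, φ, -, hne, hc⟩ :=
    hA.2.2.1 (W ⊔ Submodule.span ℝ {e}) le_sup_left (finrank_sup_span W he)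
  have hmem : ∀ v ∈ Sec W A e, v ∈ Co (A ∩ projSet (W ⊔ Submodule.span ℝ {e})) := by
    rintro v ⟨⟨h0, hv⟩, hve⟩
    refine ⟨h0, hv, ?_⟩
    obtain ⟨a, ha⟩ := Projectivization.exists_smul_eq_mk_rep ℝ v h0
    change (Projectivization.mk ℝ v h0).rep ∈ W ⊔ Submodule.span ℝ {e}
    rw [← ha]
    apply Submodule.smul_mem
    have : v = (v - e) + e := by abel
    rw [this]
    exact Submodule.add_mem_sup hve (Submodule.mem_span_singleton_self e)
  have hsub : ∀ v ∈ Co (A ∩ projSet (W ⊔ Submodule.span ℝ {e})), v ∈ Co A := by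
    rintro v ⟨h0, hv⟩
    exact ⟨h0, hv.1⟩
  have hne' : ∀ v ∈ Co (A ∩ projSet (W ⊔ Submodule.span ℝ {e})), φ v ≠ 0 := by
    intro v hv
    obtain ⟨x, hx, c, hc0, hr⟩ := Co.exists_rep hv
    have h1 := hne x hx
    rw [hr, map_smul, smul_eq_mul] at h1
    exact right_ne_zero_of_mul h1
  have hno : ∀ a ∈ Sec W A e, ∀ b ∈ Sec W A e, 0 < φ a → φ b < 0 → False := by
    intro a ha b hb h1 h2
    have := Co.convex hne hc (hmem a ha) (hmem b hb) (s := 1) (t := -1) (by linarith) (by linarith)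
      (by linarith)
    refine not_mem_W hA (hsub _ this) ?_
    have h3 := W.sub_mem ha.2 hb.2
    have h4 : (1:ℝ) • a + (-1:ℝ) • b = a - e - (b - e) := by module
    rw [h4]; exact h3
  intro a ha b hb s t hs ht hst
  have hW : s • a + t • b - e ∈ W := by
    have h3 := W.add_mem (W.smul_mem s ha.2) (W.smul_mem t hb.2)
    have h4 : s • a + t • b - e = s • (a - e) + t • (b - e) := by
      have : e = (s + t) • e := by rw [hst, one_smul]
      nth_rewrite 1 [this]; module
    rw [h4]; exact h3
  refine ⟨?_, hW⟩
  have ha0 := hne' a (hmem a ha)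
  have hb0 := hne' b (hmem b hb)
  rcases lt_or_gt_of_ne ha0 with h1 | h1 <;> rcases lt_or_gt_of_ne hb0 with h2 | h2
  · have := Co.convex hne hc (hmem a ha) (hmem b hb) (s := -s) (t := -t) (by nlinarith)
      (by nlinarith) (by
        rcases hs.eq_or_lt with h | h
        · subst h; have : t = 1 := by linarith
          subst this; linarith
        · nlinarith)
    have := Co.smul (hsub _ this) (c := -1) (by norm_num)
    convert this using 1; module
  · exact (hno b hb a ha h2 h1).elim
  · exact (hno a ha b hb h1 h2).elim
  · exact hsub _ (Co.convex hne hc (hmem a ha) (hmem b hb) (by positivity)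
      (by positivity) (by
        rcases hs.eq_or_lt with h | h
        · subst h; have : t = 1 := by linarith
          subst this; linarith
        · nlinarith))

theorem exists_closed (hA : IsLConvexConcave W A) :
    ∃ C : Set (Vec n), IsClosed C ∧ ∀ v ≠ 0, (v ∈ C ↔ v ∈ Co A) := by
  have hcont : Continuous (fun v : {v : Vec n // v ≠ 0} => Projectivization.mk ℝ v.1 v.2) :=
    continuous_quotient_mk'
  have h := hA.1.preimage hcont
  obtain ⟨C, hC, hCe⟩ := isClosed_induced_iff.1 h
  refine ⟨C, hC, fun v hv => ?_⟩
  have h2 : (⟨v, hv⟩ : {v : Vec n // v ≠ 0}) ∈ Subtype.val ⁻¹' C ↔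
    Projectivization.mk ℝ v hv ∈ A := by rw [hCe]; rfl
  exact h2.trans ⟨fun h => ⟨hv, h⟩, fun ⟨_, h⟩ => h⟩

theorem Sec.compact (hA : IsLConvexConcave W A) {e : Vec n} (he : e ∉ W) :
    IsCompact (Sec W A e) := by
  obtain ⟨C, hC, hCA⟩ := exists_closed hA
  have hWc : IsClosed (W : Set (Vec n)) := W.closed_of_finiteDimensional
  have hne : ∀ v : Vec n, v - e ∈ W → v ≠ 0 := by
    rintro v hv rfl
    apply he
    simpa using hv
  have hSe : Sec W A e = C ∩ (fun v => v - e) ⁻¹' (W : Set (Vec n)) := by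
    ext v
    constructor
    · rintro ⟨h1, h2⟩
      exact ⟨(hCA v (hne v h2)).2 h1, h2⟩
    · rintro ⟨h1, h2⟩
      exact ⟨(hCA v (hne v h2)).1 h1, h2⟩
  have hclosed : IsClosed (Sec W A e) := by
    rw [hSe]
    exact hC.inter (hWc.preimage (by fun_prop))
  refine Metric.isCompact_of_isClosed_isBounded hclosed ?_
  have hK : IsCompact (C ∩ Metric.sphere (0 : Vec n) 1) :=
    (isCompact_sphere _ _).inter_left hC
  obtain ⟨v0, hv0⟩ := Sec.nonempty hA he
  have hnorm : ∀ v ∈ Sec W A e, ‖v‖⁻¹ • v ∈ C ∩ Metric.sphere (0 : Vec n) 1 := by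
    intro v hv
    have h0 : ‖v‖ ≠ 0 := norm_ne_zero_iff.2 (hne v hv.2)
    have := Co.smul hv.1 (inv_ne_zero h0)
    refine ⟨(hCA _ this.1).2 this, ?_⟩
    simp [norm_smul, h0]
  have hWne : (W : Set (Vec n)).Nonempty := ⟨0, W.zero_mem⟩
  obtain ⟨k, hk, hmin⟩ := hK.exists_isMinOn ⟨_, hnorm v0 hv0⟩
    (Metric.continuous_infDist_pt (W : Set (Vec n))).continuousOn
  have hk0 : k ≠ 0 := by
    rintro rfl
    simpa using hk.2
  have hkW := not_mem_W hA ((hCA k hk0).1 hk.1)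
  have hpos : 0 < Metric.infDist k (W : Set (Vec n)) := (hWc.notMem_iff_infDist_pos hWne).1 hkW
  refine isBounded_iff_forall_norm_le.2 ⟨‖v0‖ / Metric.infDist k (W : Set (Vec n)), fun v hv => ?_⟩
  have h0 : 0 < ‖v‖ := norm_pos_iff.2 (hne v hv.2)
  have h1 : Metric.infDist k (W : Set (Vec n)) ≤ Metric.infDist (‖v‖⁻¹ • v) (W : Set (Vec n)) :=
    hmin (hnorm v hv)
  have h2 : ‖v‖⁻¹ • (v - v0) ∈ W := by
    apply W.smul_mem
    have := W.sub_mem hv.2 hv0.2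
    simpa using this
  have h3 := Metric.infDist_le_dist_of_mem (x := ‖v‖⁻¹ • v) (s := (W : Set (Vec n))) h2
  have h4 : dist (‖v‖⁻¹ • v) (‖v‖⁻¹ • (v - v0)) = ‖v0‖ / ‖v‖ := by
    rw [dist_eq_norm, ← smul_sub, norm_smul]
    simp [div_eq_inv_mul]
  rw [h4] at h3
  rw [le_div_iff₀ hpos, mul_comm, ← le_div_iff₀ h0]
  exact h1.trans h3

/-- The key inclusion `A_{p+q} ⊆ A_p + A_q`. -/
theorem Sec.add_sub (hA : IsLConvexConcave W A) {p q : Vec n} (hp : p ∉ W) (hq : q ∉ W)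
    {c : Vec n} (hc : c ∈ Sec W A (p + q)) :
    ∃ a ∈ Sec W A p, ∃ b ∈ Sec W A q, c = a + b := by
  by_contra hcon
  have hcS : c ∉ Sec W A p + Sec W A q := by
    rintro ⟨a, ha, b, hb, h⟩
    exact hcon ⟨a, ha, b, hb, h.symm⟩
  have hcomp : IsCompact (Sec W A p + Sec W A q) := (Sec.compact hA hp).add (Sec.compact hA hq)
  obtain ⟨f, u, hfu, huc⟩ := geometric_hahn_banach_closed_point
    ((Sec.convex hA hp).add (Sec.convex hA hq)) hcomp.isClosed hcS
  obtain ⟨a, ha, hamax⟩ := (Sec.compact hA hp).exists_isMaxOn (Sec.nonempty hA hp)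
    f.continuous.continuousOn
  obtain ⟨b, hb, hbmax⟩ := (Sec.compact hA hq).exists_isMaxOn (Sec.nonempty hA hq)
    f.continuous.continuousOn
  have hlt : f a + f b < f c := by
    have := (hfu _ (Set.add_mem_add ha hb)).trans huc
    rwa [map_add] at this
  have hdW : c - (a + b) ∈ W := by
    have := W.sub_mem hc.2 (W.add_mem ha.2 hb.2)
    convert this using 1; abel
  -- the vector in `W`
  set w := c - (a + b) with hw
  have hfw : 0 < f w := by rw [hw, map_sub, map_add]; linarith
  let F : Vec n →ₗ[ℝ] ℝ := f.toLinearMap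
  set T : Submodule ℝ (Vec n) := W ⊓ LinearMap.ker F with hT
  have hTW : T ≤ W := inf_le_left
  have hTf : ∀ v ∈ T, f v = 0 := fun v hv => hv.2
  have hwT : w ∉ T := fun h => hfw.ne' (hTf w h)
  have hTdim : finrank ℝ T + 1 = finrank ℝ W := by
    rw [← finrank_sup_span T hwT]
    have : T ⊔ Submodule.span ℝ {w} = W := by
      apply le_antisymm
      · refine sup_le hTW ?_
        rw [Submodule.span_singleton_le_iff_mem]; exact hdW
      · intro v hv
        have e : v = (v - (f v / f w) • w) + (f v / f w) • w := by abel
        rw [e]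
        refine Submodule.add_mem_sup ⟨W.sub_mem hv (W.smul_mem _ hdW), ?_⟩
          (Submodule.smul_mem _ _ (Submodule.mem_span_singleton_self w))
        change f _ = 0
        rw [map_sub, map_smul, smul_eq_mul]
        field_simp
        ring
    rw [this]
  obtain ⟨-, φ, -, hne, hcv⟩ := hA.2.2.2 T hTW hTdim
  have hne' : ∀ v ∈ Co (projImage T A)ᶜ, φ v ≠ 0 := by
    intro v hv
    obtain ⟨x, hx, c, hc0, hr⟩ := Co.exists_rep hv
    have h1 := hne x hx
    rw [hr, map_smul, smul_eq_mul] at h1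
    exact right_ne_zero_of_mul h1
  have hwC : T.mkQ w ∈ Co (projImage T A)ᶜ := by
    refine Co.compl_of T hwT fun y hy hyT => not_mem_W hA hy ?_
    have := W.add_mem (hTW hyT) hdW
    simpa using this
  have hup : ∀ p' : Vec n, p' ∉ W → ∀ a' ∈ Sec W A p', IsMaxOn f (Sec W A p') a' →
      ∀ s : ℝ, 0 < s → T.mkQ (a' + s • w) ∈ Co (projImage T A)ᶜ := by
    intro p' hp' a' ha' hm s hs
    refine Co.compl_of T (fun h => not_mem_W hA ha'.1 ?_) fun y hy hyT => ?_
    · have := W.sub_mem (hTW h) (W.smul_mem s hdW)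
      simpa using this
    · have hyS : y ∈ Sec W A p' := by
        refine ⟨hy, ?_⟩
        have := W.add_mem (W.add_mem (hTW hyT) (W.smul_mem s hdW)) ha'.2
        convert this using 1; abel
      have h1 : f y ≤ f a' := hm hyS
      have h2 := hTf _ hyT
      rw [map_sub, map_add, map_smul, smul_eq_mul] at h2
      nlinarith
  have hsign : ∀ p' : Vec n, p' ∉ W → ∀ a' ∈ Sec W A p', IsMaxOn f (Sec W A p') a' →
      0 < φ (T.mkQ (a' + (1/2 : ℝ) • w)) * φ (T.mkQ w) := by
    intro p' hp' a' ha' hm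
    by_contra hle
    have h1 := hne' _ hwC
    set α := φ (T.mkQ (a' + (1/2 : ℝ) • w)) with hα
    set β := φ (T.mkQ w) with hβ
    have h2 : 0 ≤ -α / β := by
      have : -α / β = -(α * β) / β ^ 2 := by field_simp
      rw [this]
      apply div_nonneg (by linarith) (by positivity)
    have h3 := hne' _ (hup p' hp' a' ha' hm (1/2 + -α/β) (by linarith))
    apply h3
    have : a' + (1/2 + -α/β) • w = (a' + (1/2 : ℝ) • w) + (-α/β) • w := by module
    rw [this, map_add, map_add, map_smul, map_smul, ← hα, ← hβ, smul_eq_mul]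
    field_simp
    ring
  have hsa := hsign p hp a ha hamax
  have hsb := hsign q hq b hb hbmax
  have hca := hup p hp a ha hamax (1/2) (by norm_num)
  have hcb := hup q hq b hb hbmax (1/2) (by norm_num)
  have hfin := Co.convex hne hcv hca hcb (s := φ (T.mkQ w)) (t := φ (T.mkQ w)) (by linarith)
    (by linarith) (by linarith)
  have hfin2 := Co.smul hfin (inv_ne_zero (hne' _ hwC))
  rw [← smul_add, smul_smul, inv_mul_cancel₀ (hne' _ hwC), one_smul, ← map_add] at hfin2
  have hcc : a + (1/2 : ℝ) • w + (b + (1/2 : ℝ) • w) = c := by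
    rw [hw]; module
  rw [hcc] at hfin2
  exact Co.not_compl T hc.1 (fun h => not_mem_W hA hc.1 (hTW h)) hfin2

theorem step (hA : IsLConvexConcave W A) {e₁ e₂ : Vec n} (h1 : e₁ ∉ W) (h2 : e₂ ∉ W)
    {α β : ℝ} (h : α • e₁ + β • e₂ ∉ W) {a : Vec n} (ha : a ∈ Sec W A e₁) :
    ∃ b ∈ Sec W A e₂, α • a + β • b ∈ Sec W A (α • e₁ + β • e₂) := by
  by_cases hβ : β = 0
  · subst hβ
    obtain ⟨b, hb⟩ := Sec.nonempty hA h2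
    refine ⟨b, hb, ?_⟩
    simp only [zero_smul, add_zero] at h ⊢
    apply Sec.smul ha
    rintro rfl
    simp at h
  by_cases hα : α = 0
  · subst hα
    obtain ⟨b, hb⟩ := Sec.nonempty hA h2
    refine ⟨b, hb, ?_⟩
    simp only [zero_smul, zero_add] at h ⊢
    exact Sec.smul hb hβ
  have e : α • e₁ = (α • e₁ + β • e₂) + (-β) • e₂ := by module
  have haa := Sec.smul ha hα
  rw [e] at haa
  obtain ⟨c, hc, b, hb, hcb⟩ := Sec.add_sub hA h
    (by rwa [Submodule.smul_mem_iff _ (neg_ne_zero.2 hβ)]) haa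
  have hb' := Sec.smul hb (inv_ne_zero (neg_ne_zero.2 hβ))
  rw [smul_smul, inv_mul_cancel₀ (neg_ne_zero.2 hβ), one_smul] at hb'
  refine ⟨_, hb', ?_⟩
  have : α • a + β • (-β)⁻¹ • b = c := by
    rw [hcb, smul_smul]
    have : β * (-β)⁻¹ = -1 := by field_simp
    rw [this]; module
  rw [this]; exact hc

/-- Averaging argument: fixed points for relations with convex graph. -/
theorem averaging {E : Type*} [NormedAddCommGroup E] [NormedSpace ℝ E] {X Y : Set E}
    (hX : Bornology.IsBounded X) (hXne : X.Nonempty)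
    {S T : Set (E × E)} (hS : IsCompact S) (hT : IsCompact T) (hSc : Convex ℝ S)
    (hTc : Convex ℝ T)
    (hF : ∀ a ∈ X, ∃ b ∈ Y, (a, b) ∈ S) (hG : ∀ b ∈ Y, ∃ a ∈ X, (a, b) ∈ T) :
    (S ∩ T).Nonempty := by
  choose! F hFY hFS using hF
  choose! G hGX hGT using hG
  obtain ⟨a0, ha0⟩ := hXne
  let x : ℕ → E := fun k => (fun a => G (F a))^[k] a0
  have hx : ∀ k, x k ∈ X := by
    intro k
    induction k with
    | zero => exact ha0
    | succ k ih =>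
      simp only [x, Function.iterate_succ_apply']
      exact hGX _ (hFY _ ih)
  have hxs : ∀ k, x (k + 1) = G (F (x k)) := fun k => by
    simp only [x, Function.iterate_succ_apply']
  have hD : IsClosed (S - T) := by
    rw [sub_eq_add_neg]; exact (hS.add hT.neg).isClosed
  have hDc : Convex ℝ (S - T) := hSc.sub hTc
  have hmem : ∀ k, (x k - x (k+1), (0 : E)) ∈ S - T := by
    intro k
    refine ⟨(x k, F (x k)), hFS _ (hx k), (x (k+1), F (x k)), ?_, ?_⟩
    · rw [hxs]; exact hGT _ (hFY _ (hx k))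
    · simp
  have hav : ∀ k : ℕ, (((k + 1 : ℕ) : ℝ)⁻¹ • (x 0 - x (k+1)), (0 : E)) ∈ S - T := by
    intro k
    have := hDc.sum_mem (t := Finset.range (k+1)) (w := fun _ => ((k + 1 : ℕ) : ℝ)⁻¹)
      (z := fun i => (x i - x (i+1), (0 : E))) (fun _ _ => by positivity)
      (by rw [Finset.sum_const, Finset.card_range, nsmul_eq_mul]
          exact mul_inv_cancel₀ (by positivity)) (fun i _ => hmem i)
    convert this using 1
    rw [← Finset.smul_sum, ← Finset.sum_range_sub' x (k+1)]
    ext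
    · simp [Prod.fst_sum]
    · simp [Prod.snd_sum]
  have hlim : Filter.Tendsto (fun k : ℕ => (((k + 1 : ℕ) : ℝ)⁻¹ • (x 0 - x (k+1)), (0 : E)))
      Filter.atTop (nhds (0, 0)) := by
    refine Filter.Tendsto.prodMk_nhds ?_ tendsto_const_nhds
    obtain ⟨R, hR⟩ := isBounded_iff_forall_norm_le.1 hX
    have hz : Filter.Tendsto (fun k : ℕ => ((k + 1 : ℕ) : ℝ)⁻¹ * (R + R)) Filter.atTop (nhds 0) := by
      have := (tendsto_inv_atTop_nhds_zero_nat (𝕜 := ℝ)).comp (Filter.tendsto_add_atTop_nat 1)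
      simpa using this.mul_const (R + R)
    refine squeeze_zero_norm (fun k => ?_) hz
    rw [norm_smul, Real.norm_of_nonneg (by positivity)]
    gcongr
    exact (norm_sub_le _ _).trans (add_le_add (hR _ (hx _)) (hR _ (hx _)))
  have h0 := hD.mem_of_tendsto hlim (Filter.Eventually.of_forall hav)
  obtain ⟨s, hs, t, ht, hst⟩ := h0
  have : s = t := sub_eq_zero.1 hst
  exact ⟨s, hs, this ▸ ht⟩

theorem four (hA : IsLConvexConcave W A) {e₁ e₂ : Vec n} (h1 : e₁ ∉ W) (h2 : e₂ ∉ W)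
    {α β γ δ : ℝ} (h3 : α • e₁ + β • e₂ ∉ W) (h4 : γ • e₁ + δ • e₂ ∉ W) :
    ∃ a ∈ Sec W A e₁, ∃ b ∈ Sec W A e₂, α • a + β • b ∈ Sec W A (α • e₁ + β • e₂) ∧
      γ • a + δ • b ∈ Sec W A (γ • e₁ + δ • e₂) := by
  have gen : ∀ s t : ℝ, s • e₁ + t • e₂ ∉ W →
      IsCompact ((Sec W A e₁ ×ˢ Sec W A e₂) ∩
        (fun z : Vec n × Vec n => s • z.1 + t • z.2) ⁻¹' Sec W A (s • e₁ + t • e₂)) ∧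
      Convex ℝ ((Sec W A e₁ ×ˢ Sec W A e₂) ∩
        (fun z : Vec n × Vec n => s • z.1 + t • z.2) ⁻¹' Sec W A (s • e₁ + t • e₂)) := by
    intro s t h
    constructor
    · exact ((Sec.compact hA h1).prod (Sec.compact hA h2)).inter_right
        ((Sec.compact hA h).isClosed.preimage (by fun_prop))
    · refine ((Sec.convex hA h1).prod (Sec.convex hA h2)).inter ?_
      exact (Sec.convex hA h).linear_preimage
        (s • LinearMap.fst ℝ (Vec n) (Vec n) + t • LinearMap.snd ℝ (Vec n) (Vec n))
  obtain ⟨⟨a, b⟩, ⟨⟨ha, hb⟩, h5⟩, ⟨-, h6⟩⟩ := averaging (X := Sec W A e₁) (Y := Sec W A e₂)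
    (Sec.compact hA h1).isBounded (Sec.nonempty hA h1)
    (gen α β h3).1 (gen γ δ h4).1 (gen α β h3).2 (gen γ δ h4).2
    (fun a ha => by
      obtain ⟨b, hb, h⟩ := step hA h1 h2 h3 ha
      exact ⟨b, hb, ⟨ha, hb⟩, h⟩)
    (fun b hb => by
      rw [add_comm (γ • e₁)] at h4
      obtain ⟨a, ha, h⟩ := step hA h2 h1 h4 hb
      refine ⟨a, ha, ⟨ha, hb⟩, ?_⟩
      change γ • a + δ • b ∈ Sec W A (γ • e₁ + δ • e₂)
      rw [add_comm (γ • a), add_comm (γ • e₁)]; exact h)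
  exact ⟨a, ha, b, hb, h5, h6⟩

theorem four_subspaces (hn : 2 ≤ n) (hW : finrank ℝ W = n - 1) (hA : IsLConvexConcave W A)
    {N₁ N₂ N₃ N₄ : Submodule ℝ (Vec n)} (hW1 : W ≤ N₁) (hW2 : W ≤ N₂) (hW3 : W ≤ N₃)
    (hW4 : W ≤ N₄) (hd1 : finrank ℝ N₁ = n) (hd2 : finrank ℝ N₂ = n) (hd3 : finrank ℝ N₃ = n)
    (hd4 : finrank ℝ N₄ = n) (hne : N₁ ≠ N₂) :
    ∃ M : Submodule ℝ (Vec n), finrank ℝ M = 2 ∧ ∀ N ∈ ({N₁, N₂, N₃, N₄} : Set _),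
      ∃ x ∈ A, x.rep ∈ M ∧ x.rep ∈ N := by
  have ex : ∀ N : Submodule ℝ (Vec n), W ≤ N → finrank ℝ N = n →
      ∃ e ∈ N, e ∉ W ∧ N = W ⊔ Submodule.span ℝ {e} := by
    intro N hWN hN
    have : ¬ N ≤ W := by
      intro h
      have := Submodule.finrank_mono h
      omega
    obtain ⟨e, he, heW⟩ := Set.not_subset.1 this
    refine ⟨e, he, heW, ?_⟩
    symm
    apply Submodule.eq_of_le_of_finrank_eq
    · exact sup_le hWN ((Submodule.span_singleton_le_iff_mem _ _).2 he)
    · rw [finrank_sup_span W heW]; omega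
  obtain ⟨e₁, he1, h1, hs1⟩ := ex N₁ hW1 hd1
  obtain ⟨e₂, he2, h2, hs2⟩ := ex N₂ hW2 hd2
  obtain ⟨e₃, he3, h3, hs3⟩ := ex N₃ hW3 hd3
  obtain ⟨e₄, he4, h4, hs4⟩ := ex N₄ hW4 hd4
  have h12 : e₂ ∉ N₁ := by
    intro h
    apply hne
    symm
    apply Submodule.eq_of_le_of_finrank_eq
    · rw [hs2]
      exact sup_le hW1 ((Submodule.span_singleton_le_iff_mem _ _).2 h)
    · rw [hd1, hd2]
  have htop : N₁ ⊔ Submodule.span ℝ {e₂} = ⊤ := by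
    apply Submodule.eq_top_of_finrank_eq
    rw [finrank_sup_span N₁ h12, hd1]
    simp
  have dec : ∀ v : Vec n, ∃ s t : ℝ, v - (s • e₁ + t • e₂) ∈ W := by
    intro v
    have hv : v ∈ N₁ ⊔ Submodule.span ℝ {e₂} := by rw [htop]; trivial
    obtain ⟨y, hy, z, hz, rfl⟩ := Submodule.mem_sup.1 hv
    obtain ⟨t, rfl⟩ := Submodule.mem_span_singleton.1 hz
    rw [hs1] at hy
    obtain ⟨w, hw, z', hz', rfl⟩ := Submodule.mem_sup.1 hy
    obtain ⟨s, rfl⟩ := Submodule.mem_span_singleton.1 hz'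
    refine ⟨s, t, ?_⟩
    convert hw using 1; abel
  obtain ⟨α, β, hd3'⟩ := dec e₃
  obtain ⟨γ, δ, hd4'⟩ := dec e₄
  have h3' : α • e₁ + β • e₂ ∉ W := fun h => h3 (by have := W.add_mem hd3' h; simpa using this)
  have h4' : γ • e₁ + δ • e₂ ∉ W := fun h => h4 (by have := W.add_mem hd4' h; simpa using this)
  obtain ⟨a, ha, b, hb, hc, hd⟩ := four hA h1 h2 h3' h4'
  have memN : ∀ (N : Submodule ℝ (Vec n)) (e v : Vec n), W ≤ N → e ∈ N → v ∈ Sec W A e →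
      v ∈ N := by
    intro N e v hWN he hv
    have := N.add_mem (hWN hv.2) he
    simpa using this
  have haN := memN N₁ e₁ a hW1 he1 ha
  have hbN : b ∉ N₁ := fun h => h12 (by
    have := N₁.sub_mem h (hW1 hb.2)
    simpa using this)
  have hcN : α • a + β • b ∈ N₃ := by
    refine memN N₃ e₃ _ hW3 he3 (Sec.congr hc ?_)
    have := W.neg_mem hd3'
    rwa [neg_sub] at this
  have hdN : γ • a + δ • b ∈ N₄ := by
    refine memN N₄ e₄ _ hW4 he4 (Sec.congr hd ?_)
    have := W.neg_mem hd4'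
    rwa [neg_sub] at this
  have hit : ∀ (M N : Submodule ℝ (Vec n)) (v : Vec n), v ∈ Co A → v ∈ M → v ∈ N →
      ∃ x ∈ A, x.rep ∈ M ∧ x.rep ∈ N := by
    intro M N v hv hM hN
    obtain ⟨x, hx, c, hc0, hr⟩ := Co.exists_rep hv
    exact ⟨x, hx, hr ▸ M.smul_mem c hM, hr ▸ N.smul_mem c hN⟩
  have hbs : b ∉ Submodule.span ℝ {a} := fun h =>
    hbN ((Submodule.span_singleton_le_iff_mem _ _).2 haN h)
  have haM : a ∈ Submodule.span ℝ {a} ⊔ Submodule.span ℝ {b} :=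
    Submodule.mem_sup_left (Submodule.mem_span_singleton_self a)
  have hbM : b ∈ Submodule.span ℝ {a} ⊔ Submodule.span ℝ {b} :=
    Submodule.mem_sup_right (Submodule.mem_span_singleton_self b)
  refine ⟨Submodule.span ℝ {a} ⊔ Submodule.span ℝ {b}, ?_, ?_⟩
  · rw [finrank_sup_span _ hbs, finrank_span_singleton ha.1.1]
  · rintro N (rfl | rfl | rfl | rfl)
    · exact hit _ _ a ha.1 haM haN
    · exact hit _ _ b hb.1 hbM (memN _ e₂ b hW2 he2 hb)
    · exact hit _ _ _ hc.1 (Submodule.add_mem _ (Submodule.smul_mem _ _ haM)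
        (Submodule.smul_mem _ _ hbM)) hcN
    · exact hit _ _ _ hd.1 (Submodule.add_mem _ (Submodule.smul_mem _ _ haM)
        (Submodule.smul_mem _ _ hbM)) hdN

end

/-- Let `A ⊆ ℝPⁿ` be `L`-convex-concave with `dim L = n − 2`.  For any
four hyperplanes `N 0, …, N 3` of `ℝPⁿ` containing `L` there is a projective line
meeting all four sections `A ∩ N i`. -/
theorem statement18 (n : ℕ) (hn : 2 ≤ n) (W : Submodule ℝ (Vec n))
    (hW : finrank ℝ W = n - 1)
    (A : Set (Pt n)) (hA : IsLConvexConcave W A)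
    (N : Fin 4 → Submodule ℝ (Vec n))
    (hNW : ∀ i, W ≤ N i) (hNdim : ∀ i, finrank ℝ (N i) = n) :
    ∃ M : Submodule ℝ (Vec n), finrank ℝ M = 2 ∧
      ∀ i, ∃ x ∈ A, x.rep ∈ M ∧ x.rep ∈ N i := by
  by_cases h01 : N 0 = N 1
  · by_cases h02 : N 0 = N 2
    · by_cases h03 : N 0 = N 3
      · have hlt : ¬ (⊤ : Submodule ℝ (Vec n)) ≤ N 0 := by
          intro h
          have := Submodule.finrank_mono h
          rw [hNdim, finrank_top] at this
          simp at this
        obtain ⟨e, -, he⟩ := Set.not_subset.1 hlt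
        have heW : e ∉ W := fun h => he (hNW 0 h)
        have hne : N 0 ≠ W ⊔ Submodule.span ℝ {e} := by
          intro h
          apply he
          change e ∈ N 0
          rw [h]
          exact Submodule.mem_sup_right (Submodule.mem_span_singleton_self e)
        obtain ⟨M, hM, h⟩ := four_subspaces hn hW hA (hNW 0) le_sup_left (hNW 0) (hNW 0)
          (hNdim 0) (by rw [finrank_sup_span W heW]; omega) (hNdim 0) (hNdim 0) hne
        have h0 := h (N 0) (by simp)
        refine ⟨M, hM, fun i => ?_⟩
        fin_cases i
        · exact h0
        · exact h01 ▸ h0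
        · exact h02 ▸ h0
        · exact h03 ▸ h0
      · obtain ⟨M, hM, h⟩ := four_subspaces hn hW hA (hNW 0) (hNW 3) (hNW 1) (hNW 2)
          (hNdim 0) (hNdim 3) (hNdim 1) (hNdim 2) h03
        refine ⟨M, hM, fun i => h _ ?_⟩
        fin_cases i <;> simp
    · obtain ⟨M, hM, h⟩ := four_subspaces hn hW hA (hNW 0) (hNW 2) (hNW 1) (hNW 3)
        (hNdim 0) (hNdim 2) (hNdim 1) (hNdim 3) h02
      refine ⟨M, hM, fun i => h _ ?_⟩
      fin_cases i <;> simp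
  · obtain ⟨M, hM, h⟩ := four_subspaces hn hW hA (hNW 0) (hNW 1) (hNW 2) (hNW 3)
      (hNdim 0) (hNdim 1) (hNdim 2) (hNdim 3) h01
    refine ⟨M, hM, fun i => h _ ?_⟩
    fin_cases i <;> simp

end CC
end
end

section
/- Let L be a projective line in ℝP³ (a projective subspace with dim L = 1) and let A ⊆ ℝP³ be an L-convex-concave set. Then A contains a projective line. -/
open Module Set Pointwise

noncomputable section

namespace CC

variable {M : Type*} [AddCommGroup M] [Module ℝ M]

/-- Separately sublinear functions with the central symmetry. -/
structure BiSub (h : ℝ × ℝ → ℝ × ℝ → ℝ) : Prop where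
  addL : ∀ x y u, h (x + y) u ≤ h x u + h y u
  addR : ∀ x u v, h x (u + v) ≤ h x u + h x v
  smulL : ∀ (c : ℝ) x u, 0 ≤ c → h (c • x) u = c * h x u
  smulR : ∀ (c : ℝ) x u, 0 ≤ c → h x (c • u) = c * h x u
  neg : ∀ x u, h (-x) (-u) = h x u

/-- The bilinear form with coefficients `B`. -/
def bf (B : Fin 4 → ℝ) (x u : ℝ × ℝ) : ℝ :=
  B 0 * x.1 * u.1 + B 1 * x.1 * u.2 + B 2 * x.2 * u.1 + B 3 * x.2 * u.2

/-- The determinant of two plane vectors. -/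
def br (x y : ℝ × ℝ) : ℝ := x.1 * y.2 - x.2 * y.1

lemma BiSub.zeroL {h} (H : BiSub h) (u) : h 0 u = 0 := by
  have := H.smulL 0 0 u le_rfl
  simpa using this

lemma BiSub.zeroR {h} (H : BiSub h) (u) : h u 0 = 0 := by
  have := H.smulR 0 u 0 le_rfl
  simpa using this

lemma BiSub.negL {h} (H : BiSub h) (x u) : h (-x) u = h x (-u) := by
  have := H.neg x (-u)
  simpa using this

lemma BiSub.negsum {h} (H : BiSub h) (x u) : 0 ≤ h x u + h (-x) u := by
  have := H.addL x (-x) u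
  simpa [H.zeroL] using this

lemma BiSub.sub_bf {h} (H : BiSub h) (B) : BiSub (fun x u => h x u - bf B x u) where
  addL x y u := by
    have := H.addL x y u
    simp only [bf, Prod.fst_add, Prod.snd_add] at *; linarith
  addR x y u := by
    have := H.addR x y u
    simp only [bf, Prod.fst_add, Prod.snd_add] at *; linarith
  smulL c x u hc := by
    have := H.smulL c x u hc
    simp only [bf, Prod.smul_fst, Prod.smul_snd, smul_eq_mul] at *; rw [this]; ring
  smulR c x u hc := by
    have := H.smulR c x u hc
    simp only [bf, Prod.smul_fst, Prod.smul_snd, smul_eq_mul] at *; rw [this]; ring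
  neg x u := by
    have := H.neg x u
    simp only [bf, Prod.fst_neg, Prod.snd_neg] at *; rw [this]; ring

/-- Values on a rank one multiple of a node. -/
lemma BiSub.term_pos {h} (H : BiSub h) {s : ℝ} (hs : s = 1 ∨ s = -1) {e f : ℝ × ℝ}
    (h0 : h (s • e) f = 0) (p r : ℝ) (hc : 0 ≤ s * (p * r)) : h (p • e) (r • f) = 0 := by
  have key : h (p • e) (r • f) = (s * (p * r)) * h (s • e) f := by
    rcases le_total 0 r with hr | hr
    · rw [H.smulR r _ _ hr]
      rcases hs with rfl | rfl
      · rcases hr.eq_or_lt with rfl | hr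
        · simp
        have hp : 0 ≤ p := by
          by_contra hp; push Not at hp; nlinarith
        rw [H.smulL p _ _ hp, one_smul]; ring
      · rcases hr.eq_or_lt with rfl | hr
        · simp
        have hp : 0 ≤ -p := by
          by_contra hp; push Not at hp; nlinarith
        rw [show p • e = (-p) • ((-1 : ℝ) • e) by simp, H.smulL _ _ _ hp]; ring
    · rw [← H.neg, ← neg_smul, ← neg_smul, H.smulR (-r) _ _ (by linarith)]
      rcases hs with rfl | rfl
      · rcases hr.eq_or_lt with rfl | hr
        · simp
        have hp : 0 ≤ -p := by
          by_contra hp; push Not at hp; nlinarith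
        rw [H.smulL _ _ _ hp, one_smul]; ring
      · rcases hr.eq_or_lt with rfl | hr
        · simp
        have hp : 0 ≤ p := by
          by_contra hp; push Not at hp; nlinarith
        rw [show (-p) • e = p • ((-1 : ℝ) • e) by simp, H.smulL _ _ _ hp]; ring
  rw [key, h0, mul_zero]

lemma BiSub.term_neg {h} (H : BiSub h) {s : ℝ} (hs : s = 1 ∨ s = -1) {e f : ℝ × ℝ}
    (h0 : h (s • e) f = 0) (p r : ℝ) (hc : s * (p * r) ≤ 0) : h (-(p • e)) (r • f) = 0 := by
  rw [← neg_smul]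
  exact H.term_pos hs h0 _ _ (by nlinarith)

lemma BiSub.term_nonneg {h} (H : BiSub h) {s : ℝ} (hs : s = 1 ∨ s = -1) {e f : ℝ × ℝ}
    (h0 : h (s • e) f = 0) (p r : ℝ) : 0 ≤ h (p • e) (r • f) := by
  rcases le_total 0 (s * (p * r)) with hc | hc
  · exact (H.term_pos hs h0 _ _ hc).ge
  · have h1 := H.term_neg hs h0 _ _ hc
    have h2 := H.negsum (p • e) (r • f)
    linarith

/-- One column. -/
lemma BiSub.col_nonneg {h} (H : BiSub h) {s t : ℝ} (hs : s = 1 ∨ s = -1) (ht : t = 1 ∨ t = -1)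
    {e e' f : ℝ × ℝ} (h0 : h (s • e) f = 0) (h0' : h (t • e') f = 0) (p p' r : ℝ)
    (hc : s * (p * r) ≤ 0 ∨ t * (p' * r) ≤ 0) : 0 ≤ h (p • e + p' • e') (r • f) := by
  rcases hc with hc | hc
  · have h1 := H.term_neg hs h0 _ _ hc
    have h2 := H.term_nonneg ht h0' p' r
    have h3 := H.addL (p • e + p' • e') (-(p • e)) (r • f)
    rw [show p • e + p' • e' + -(p • e) = p' • e' by abel] at h3
    linarith
  · have h1 := H.term_neg ht h0' _ _ hc
    have h2 := H.term_nonneg hs h0 p r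
    have h3 := H.addL (p • e + p' • e') (-(p' • e')) (r • f)
    rw [show p • e + p' • e' + -(p' • e') = p • e by abel] at h3
    linarith

lemma BiSub.col_neg {h} (H : BiSub h) {s t : ℝ} (hs : s = 1 ∨ s = -1) (ht : t = 1 ∨ t = -1)
    {e e' f : ℝ × ℝ} (h0 : h (s • e) f = 0) (h0' : h (t • e') f = 0) (p p' r : ℝ)
    (hc : s * (p * r) ≤ 0) (hc' : t * (p' * r) ≤ 0) : h (p • e + p' • e') (-(r • f)) ≤ 0 := by
  have h1 := H.term_neg hs h0 _ _ hc
  have h2 := H.term_neg ht h0' _ _ hc'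
  have h3 := H.addL (-(p • e)) (-(p' • e')) (r • f)
  rw [← H.negL, neg_add]
  linarith

/-- Node lemma, normalized. -/
lemma BiSub.node0 {g} (G : BiSub g) {s : ℝ} (hs : s = 1 ∨ s = -1) {e e' f f' : ℝ × ℝ}
    (h11 : g e f = 0) (h12 : g e f' = 0) (h21 : g e' f = 0) (h22 : g (s • e') f' = 0)
    (p p' r r' : ℝ)
    (hc : (p * r ≤ 0 ∧ p' * r ≤ 0 ∧ (p * r' ≤ 0 ∨ s * (p' * r') ≤ 0)) ∨
      ((p * r ≤ 0 ∨ p' * r ≤ 0) ∧ p * r' ≤ 0 ∧ s * (p' * r') ≤ 0)) :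
    0 ≤ g (p • e + p' • e') (r • f + r' • f') := by
  have o : (1 : ℝ) = 1 ∨ (1 : ℝ) = -1 := Or.inl rfl
  have k11 : g ((1 : ℝ) • e) f = 0 := by rwa [one_smul]
  have k12 : g ((1 : ℝ) • e) f' = 0 := by rwa [one_smul]
  have k21 : g ((1 : ℝ) • e') f = 0 := by rwa [one_smul]
  rcases hc with ⟨a, b, c⟩ | ⟨c, a, b⟩
  · have h1 := G.col_neg o o k11 k21 p p' r (by linarith) (by linarith)
    have h2 := G.col_nonneg o hs k12 h22 p p' r' (by simpa using c)
    have h3 := G.addR (p • e + p' • e') (r • f + r' • f') (-(r • f))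
    rw [show r • f + r' • f' + -(r • f) = r' • f' by abel] at h3
    linarith
  · have h1 := G.col_neg o hs k12 h22 p p' r' (by linarith) (by linarith)
    have h2 := G.col_nonneg o o k11 k21 p p' r (by simpa using c)
    have h3 := G.addR (p • e + p' • e') (r • f + r' • f') (-(r' • f'))
    rw [show r • f + r' • f' + -(r' • f') = r • f by abel] at h3
    linarith

lemma exists_bf (e e' f f' : ℝ × ℝ) (he : br e e' ≠ 0) (hf : br f f' ≠ 0) (a b c d : ℝ) :
    ∃ B, bf B e f = a ∧ bf B e f' = b ∧ bf B e' f = c ∧ bf B e' f' = d := by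
  obtain ⟨e1, e2⟩ := e
  obtain ⟨e1', e2'⟩ := e'
  obtain ⟨f1, f2⟩ := f
  obtain ⟨f1', f2'⟩ := f'
  simp only [br] at he hf
  have hm := mul_ne_zero he hf
  set D := (e1 * e2' - e2 * e1') * (f1 * f2' - f2 * f1') with hD
  refine ⟨![(a * e2' * f2' - b * e2' * f2 - c * e2 * f2' + d * e2 * f2) / D,
    (-a * e2' * f1' + b * e2' * f1 + c * e2 * f1' - d * e2 * f1) / D,
    (-a * e1' * f2' + b * e1' * f2 + c * e1 * f2' - d * e1 * f2) / D,
    (a * e1' * f1' - b * e1' * f1 - c * e1 * f1' + d * e1 * f1) / D], ?_, ?_, ?_, ?_⟩ <;>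
  · simp [bf]
    field_simp
    rw [hD]; ring

/-- Node lemma. -/
lemma BiSub.node {h} (H : BiSub h) {s : ℝ} (hs : s = 1 ∨ s = -1) {e e' f f' : ℝ × ℝ}
    (he : br e e' ≠ 0) (hf : br f f' ≠ 0) :
    ∃ B, ∀ p p' r r' : ℝ,
    ((p * r ≤ 0 ∧ p' * r ≤ 0 ∧ (p * r' ≤ 0 ∨ s * (p' * r') ≤ 0)) ∨
      ((p * r ≤ 0 ∨ p' * r ≤ 0) ∧ p * r' ≤ 0 ∧ s * (p' * r') ≤ 0)) →
    bf B (p • e + p' • e') (r • f + r' • f') ≤ h (p • e + p' • e') (r • f + r' • f') := by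
  obtain ⟨B, h1, h2, h3, h4⟩ := exists_bf e e' f f' he hf (h e f) (h e f') (h e' f)
    (s * h (s • e') f')
  refine ⟨B, fun p p' r r' hc => ?_⟩
  have := (H.sub_bf B).node0 hs (e := e) (e' := e') (f := f) (f' := f') (by simp [h1])
    (by simp [h2]) (by simp [h3]) (by
      have : bf B (s • e') f' = s * bf B e' f' := by simp [bf]; ring
      rw [this, h4]; rcases hs with rfl | rfl <;> simp) p p' r r' hc
  linarith

lemma cramer (e e' x : ℝ × ℝ) (he : br e e' ≠ 0) :
    x = (br x e' / br e e') • e + (br e x / br e e') • e' := by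
  ext
  · simp; field_simp; simp [br]; ring
  · simp; field_simp; simp [br]; ring

/-- Staircase lemma. -/
lemma BiSub.stair {h} (H : BiSub h) {w w' f f' : ℝ × ℝ} (hw : br w w' ≠ 0) (hf : 0 < br f f') :
    ∃ B, ∀ x u : ℝ × ℝ, (br u f' ≥ 0 ∧ br f u ≥ 0 ∧ br w x ≤ 0) ∨
      (br u f' ≤ 0 ∧ br f u ≥ 0 ∧ 0 ≤ br w' x) → bf B x u ≤ h x u := by
  obtain ⟨B, hB⟩ := H.node (s := -1) (Or.inr rfl) (e := (1 / br w w') • w')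
    (e' := (1 / br w w') • -w) (f := f) (f' := f') (by
      have : br ((1 / br w w') • w') ((1 / br w w') • -w) = 1 / br w w' := by
        simp only [br, Prod.smul_fst, Prod.smul_snd, smul_eq_mul, Prod.fst_neg,
          Prod.snd_neg] at hw ⊢
        field_simp; ring
      rw [this]; positivity) hf.ne'
  refine ⟨B, fun x u hc => ?_⟩
  have hu := cramer f f' u hf.ne'
  have hx : x = (br w x) • ((1 / br w w') • w') + (br w' x) • ((1 / br w w') • -w) := by
    ext
    · simp; field_simp; simp [br]; ring
    · simp; field_simp; simp [br]; ring
  have := hB (br w x) (br w' x) (br u f' / br f f') (br f u / br f f') ?_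
  · rwa [← hu, ← hx] at this
  rcases hc with ⟨h1, h2, h3⟩ | ⟨h1, h2, h3⟩
  · have k1 : 0 ≤ br u f' / br f f' := div_nonneg h1 hf.le
    have k2 : 0 ≤ br f u / br f f' := div_nonneg h2 hf.le
    rcases le_total 0 (br w' x) with h4 | h4
    · right
      exact ⟨Or.inl (mul_nonpos_of_nonpos_of_nonneg h3 k1), mul_nonpos_of_nonpos_of_nonneg h3 k2,
        by nlinarith [mul_nonneg h4 k2]⟩
    · left
      exact ⟨mul_nonpos_of_nonpos_of_nonneg h3 k1, mul_nonpos_of_nonpos_of_nonneg h4 k1,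
        Or.inl (mul_nonpos_of_nonpos_of_nonneg h3 k2)⟩
  · have k1 : br u f' / br f f' ≤ 0 := div_nonpos_of_nonpos_of_nonneg h1 hf.le
    have k2 : 0 ≤ br f u / br f f' := div_nonneg h2 hf.le
    have k3 := mul_nonneg h3 k2
    have k4 := mul_nonpos_of_nonneg_of_nonpos h3 k1
    rcases le_total 0 (br w x) with h4 | h4
    · left
      exact ⟨mul_nonpos_of_nonneg_of_nonpos h4 k1, k4, Or.inr (by linarith)⟩
    · right
      exact ⟨Or.inr k4, mul_nonpos_of_nonpos_of_nonneg h4 k2, by linarith⟩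

/-- The pairs are in convex position: `u i` are in counterclockwise order in a half plane, and
the `x i` are pairwise independent. -/
structure Gen (x u : Fin 5 → ℝ × ℝ) : Prop where
  u : ∀ i j, i < j → 0 < br (u i) (u j)
  x : ∀ i j, i ≠ j → br (x i) (x j) ≠ 0

/-- Rotation. -/
def rot (x : Fin 5 → ℝ × ℝ) : Fin 5 → ℝ × ℝ := ![x 1, x 2, x 3, x 4, -x 0]

lemma br_negR (x y) : br x (-y) = - br x y := by simp [br]; ring
lemma br_negL (x y) : br (-x) y = - br x y := by simp [br]; ring
lemma br_swap (x y) : br y x = - br x y := by simp [br]; ring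

lemma Gen.rot {x u} (G : Gen x u) : Gen (rot x) (rot u) where
  u i j hij := by
    have h1 := G.u
    fin_cases i <;> fin_cases j <;> simp [CC.rot, br_negR] at hij ⊢ <;>
      first | (apply G.u; decide) | (rw [br_swap, neg_lt_zero]; apply G.u; decide)
  x i j hij := by
    have h1 := G.x
    fin_cases i <;> fin_cases j <;> simp [CC.rot, br_negR, br_negL] at hij ⊢ <;>
      (apply G.x; decide)

lemma BiSub.rot {h} (H : BiSub h) {x u B} (hB : ∀ i, bf B (rot x i) (rot u i) ≤ h (rot x i) (rot u i)) :
    ∀ i, bf B (x i) (u i) ≤ h (x i) (u i) := by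
  intro i
  fin_cases i
  · have := hB 4
    simp only [CC.rot] at this
    have e : bf B (-x 0) (-u 0) = bf B (x 0) (u 0) := by simp [bf]
    simpa [H.neg, e] using this
  · simpa [CC.rot] using hB 0
  · simpa [CC.rot] using hB 1
  · simpa [CC.rot] using hB 2
  · simpa [CC.rot] using hB 3

/-- Case A. -/
lemma BiSub.caseA {h} (H : BiSub h) {x u} (G : Gen x u)
    (hc : br (x 0) (x 1) * br (x 1) (x 2) ≤ 0 ∨ br (x 0) (x 1) * br (x 2) (x 0) ≤ 0 ∨
      br (x 1) (x 2) * br (x 2) (x 0) ≤ 0) : ∃ B, ∀ i, bf B (x i) (u i) ≤ h (x i) (u i) := by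
  have hw : ∃ w : ℝ × ℝ, w ≠ 0 ∧ br w (x 0) ≤ 0 ∧ br w (x 1) ≤ 0 ∧ br w (x 2) ≤ 0 := by
    have main : ∀ a b c : ℝ × ℝ, a ≠ 0 → 0 ≤ br a b * br a c →
        ∃ w : ℝ × ℝ, w ≠ 0 ∧ br w a ≤ 0 ∧ br w b ≤ 0 ∧ br w c ≤ 0 := by
      intro a b c ha hm
      have haa : br a a = 0 := by simp [br]; ring
      rcases mul_nonneg_iff.1 hm with ⟨h1, h2⟩ | ⟨h1, h2⟩
      · exact ⟨-a, by simpa using ha, by simp [br_negL, haa], by simpa [br_negL] using h1,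
          by simpa [br_negL] using h2⟩
      · exact ⟨a, ha, haa.le, h1, h2⟩
    have ne : ∀ i j, i ≠ j → x i ≠ 0 := by
      intro i j hij h0
      apply G.x i j hij
      simp [h0, br]
    rcases hc with hc | hc | hc
    · obtain ⟨w, h0, h1, h2, h3⟩ := main (x 1) (x 0) (x 2) (ne 1 2 (by decide)) (by
        rw [br_swap (x 0) (x 1)]; linarith)
      exact ⟨w, h0, h2, h1, h3⟩
    · obtain ⟨w, h0, h1, h2, h3⟩ := main (x 0) (x 1) (x 2) (ne 0 2 (by decide)) (by
        rw [br_swap (x 2) (x 0)]; linarith)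
      exact ⟨w, h0, h1, h2, h3⟩
    · obtain ⟨w, h0, h1, h2, h3⟩ := main (x 2) (x 0) (x 1) (ne 2 1 (by decide)) (by
        rw [br_swap (x 1) (x 2)]; linarith)
      exact ⟨w, h0, h2, h3, h1⟩
  obtain ⟨w, w0, w1, w2, w3⟩ := hw
  have hw' : ∃ w' : ℝ × ℝ, br w w' ≠ 0 ∧ 0 ≤ br w' (x 3) ∧ 0 ≤ br w' (x 4) := by
    have hn := G.x 3 4 (by decide)
    set b := br (x 3) (x 4) with hb
    have e33 : br (x 3) (x 3) = 0 := by simp [br]; ring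
    have e44 : br (x 4) (x 4) = 0 := by simp [br]; ring
    by_cases k : br w (x 3) = 0
    · have k4 : br w (x 4) ≠ 0 := by
        intro k4
        apply w0
        have := cramer (x 3) (x 4) w hn
        rw [k4, br_swap w (x 3), k] at this
        simpa using this
      refine ⟨(-b) • x 4, ?_, ?_, ?_⟩
      · have : br w (-b • x 4) = -b * br w (x 4) := by simp [br]; ring
        rw [this]; simp [hn, k4]
      · have : br (-b • x 4) (x 3) = b * b := by rw [hb]; simp [br]; ring
        rw [this]; exact mul_self_nonneg b
      · have : br (-b • x 4) (x 4) = 0 := by simp [br]; ring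
        rw [this]
    · refine ⟨b • x 3, ?_, ?_, ?_⟩
      · have : br w (b • x 3) = b * br w (x 3) := by simp [br]; ring
        rw [this]; simp [hn, k]
      · have : br (b • x 3) (x 3) = 0 := by simp [br]; ring
        rw [this]
      · have : br (b • x 3) (x 4) = b * b := by rw [hb]; simp [br]; ring
        rw [this]; exact mul_self_nonneg b
  obtain ⟨w', k0, k3, k4⟩ := hw'
  obtain ⟨B, hB⟩ := H.stair (f := u 0) (f' := u 2) k0 (G.u 0 2 (by decide))
  have z : ∀ i, br (u i) (u i) = 0 := by intro i; simp [br]; ring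
  have gu := fun i j hij => (G.u i j hij).le
  refine ⟨B, fun i => hB _ _ ?_⟩
  fin_cases i
  · exact Or.inl ⟨gu 0 2 (by decide), (z 0).ge, w1⟩
  · exact Or.inl ⟨gu 1 2 (by decide), gu 0 1 (by decide), w2⟩
  · exact Or.inl ⟨(z 2).ge, gu 0 2 (by decide), w3⟩
  · refine Or.inr ⟨?_, gu 0 3 (by decide), k3⟩
    have := gu 2 3 (by decide)
    simp only [br] at this ⊢; simp; linarith
  · refine Or.inr ⟨?_, gu 0 4 (by decide), k4⟩
    have := gu 2 4 (by decide)
    simp only [br] at this ⊢; simp; linarith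

/-- Case B. -/
lemma BiSub.caseB {h} (H : BiSub h) {x u} (G : Gen x u) {s : ℝ}
    (h01 : 0 < s * br (x 0) (x 1)) (h20 : 0 < s * br (x 2) (x 0)) (h12 : 0 < s * br (x 1) (x 2))
    (h30 : 0 < s * br (x 3) (x 0)) (h31 : 0 < s * br (x 3) (x 1))
    (h04 : 0 < s * br (x 0) (x 4)) (h41 : 0 < s * br (x 4) (x 1)) :
    ∃ B, ∀ i, bf B (x i) (u i) ≤ h (x i) (u i) := by
  have key : ∀ a b : ℝ, 0 < s * a → 0 < s * b → 0 ≤ a / b := by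
    intro a b ha hb
    have : 0 < a * b := by
      have := mul_pos ha hb
      have e : s * a * (s * b) = s^2 * (a*b) := by ring
      rw [e] at this
      exact (pos_iff_pos_of_mul_pos this).1 (by
        rcases eq_or_ne s 0 with rfl | h
        · simp at ha
        · positivity)
    rw [div_eq_mul_inv]
    have hb0 : b ≠ 0 := by rintro rfl; simp at hb
    rw [show a * b⁻¹ = (a * b) * (b⁻¹)^2 by field_simp]
    positivity
  obtain ⟨B, hB⟩ := H.node (s := 1) (Or.inl rfl) (e := -x 0) (e' := x 1) (f := u 2)
    (f' := u 4) (by rw [br_negL]; simpa using G.x 0 1 (by decide)) (G.u 2 4 (by decide)).ne'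
  refine ⟨B, fun i => ?_⟩
  have hu := cramer (u 2) (u 4) (u i) (G.u 2 4 (by decide)).ne'
  have hx : x i = (-(br (x i) (x 1) / br (x 0) (x 1))) • (-x 0) +
      (br (x 0) (x i) / br (x 0) (x 1)) • x 1 := by
    have := cramer (x 0) (x 1) (x i) (G.x 0 1 (by decide))
    simpa using this
  have := hB (-(br (x i) (x 1) / br (x 0) (x 1))) (br (x 0) (x i) / br (x 0) (x 1))
    (br (u i) (u 4) / br (u 2) (u 4)) (br (u 2) (u i) / br (u 2) (u 4)) ?_
  · rwa [← hu, ← hx] at this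
  have d24 := G.u 2 4 (by decide)
  have n01 := G.x 0 1 (by decide)
  have z : ∀ a, br a a = 0 := by intro i; simp [br]; ring
  have gu := fun i j hij => (div_nonneg (G.u i j hij).le d24.le)
  have sw : ∀ a b, br a b / br (u 2) (u 4) = - (br b a / br (u 2) (u 4)) := by
    intro a b; rw [br_swap b a]; ring
  have sx : ∀ a b, br a b / br (x 0) (x 1) = - (br b a / br (x 0) (x 1)) := by
    intro a b; rw [br_swap b a]; ring
  fin_cases i
  · have a1 := gu 0 4 (by decide)
    have a2 := gu 0 2 (by decide)
    simp only [Fin.zero_eta, Fin.mk_one, Fin.reduceFinMk, z, div_self n01]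
    rw [sw (u 2)]
    left; refine ⟨by linarith, by simp, Or.inr (by simp)⟩
  · have a1 := gu 1 4 (by decide)
    have a2 := gu 1 2 (by decide)
    simp only [Fin.zero_eta, Fin.mk_one, Fin.reduceFinMk, z, div_self n01]
    rw [sw (u 2)]
    right; refine ⟨Or.inl (by simp), by simp, by linarith⟩
  · have b1 := key _ _ h12 h01
    have b2 := key _ _ h20 h01
    simp only [Fin.zero_eta, Fin.mk_one, Fin.reduceFinMk, z, div_self d24.ne']
    rw [sx (x 2) (x 1), sx (x 0) (x 2)]
    right; refine ⟨Or.inr (by linarith), by simp, by simp⟩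
  · have b1 := key _ _ h31 h01
    have b2 := key _ _ h30 h01
    have a1 := gu 3 4 (by decide)
    have a2 := gu 2 3 (by decide)
    simp only [Fin.zero_eta, Fin.mk_one, Fin.reduceFinMk]
    rw [sx (x 0) (x 3)]
    left; refine ⟨?_, ?_, Or.inl ?_⟩ <;> nlinarith [mul_nonneg b1 a1, mul_nonneg b2 a1, mul_nonneg b1 a2]
  · have b1 := key _ _ h41 h01
    have b2 := key _ _ h04 h01
    simp only [Fin.zero_eta, Fin.mk_one, Fin.reduceFinMk, z, div_self d24.ne']
    left; refine ⟨by simp, by simp, Or.inl (by linarith)⟩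

/-- The five point lemma for convex position. -/
lemma BiSub.five {h} (H : BiSub h) {x u} (G : Gen x u) :
    ∃ B, ∀ i, bf B (x i) (u i) ≤ h (x i) (u i) := by
  by_contra hno
  have step : ∀ {x u : Fin 5 → ℝ × ℝ}, (¬ ∃ B, ∀ i, bf B (x i) (u i) ≤ h (x i) (u i)) →
      ¬ ∃ B, ∀ i, bf B (CC.rot x i) (CC.rot u i) ≤ h (CC.rot x i) (CC.rot u i) := by
    intro x u hn ⟨B, hB⟩
    exact hn ⟨B, H.rot hB⟩
  have c0 := mt (H.caseA G) hno
  have c1 := mt (H.caseA G.rot) (step hno)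
  have c2 := mt (H.caseA G.rot.rot) (step (step hno))
  have c3 := mt (H.caseA G.rot.rot.rot) (step (step (step hno)))
  have c4 := mt (H.caseA G.rot.rot.rot.rot) (step (step (step (step hno))))
  simp only [CC.rot, not_or, not_le] at c0 c1 c2 c3 c4
  obtain ⟨a1, a2, a3⟩ := c0
  obtain ⟨b1, b2, b3⟩ := c1
  obtain ⟨d1, d2, d3⟩ := c2
  obtain ⟨e1, e2, e3⟩ := c3
  obtain ⟨f1, f2, f3⟩ := c4
  change 0 < br (x 1) (x 2) * br (x 2) (x 3) at b1
  change 0 < br (x 1) (x 2) * br (x 3) (x 1) at b2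
  change 0 < br (x 2) (x 3) * br (x 3) (x 4) at d1
  change 0 < br (x 3) (x 4) * br (x 4) (-x 0) at e1
  change 0 < br (x 3) (x 4) * br (-x 0) (x 3) at e2
  change 0 < br (x 4) (-x 0) * br (-x 1) (x 4) at f2
  apply hno
  have n01 := G.x 0 1 (by decide)
  obtain ⟨s, hs⟩ : ∃ s : ℝ, 0 < s * br (x 0) (x 1) :=
    ⟨br (x 0) (x 1), mul_self_pos.2 n01⟩
  have sg : ∀ a b : ℝ, 0 < s * a → 0 < a * b → 0 < s * b := by
    intro a b h1 h2
    have h3 := mul_pos h1 h2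
    have h4 : s * a * (a * b) = a ^ 2 * (s * b) := by ring
    rw [h4] at h3
    exact (pos_iff_pos_of_mul_pos h3).1 (by
      have : a ≠ 0 := by rintro rfl; simp at h1
      positivity)
  have p12 := sg _ _ hs a1
  have p23 := sg _ _ p12 b1
  have p34 := sg _ _ p23 d1
  have p40 := sg _ _ p34 e1
  have p14 := sg _ _ p40 f2
  refine H.caseB G hs (sg _ _ hs a2) p12 ?_ (sg _ _ p12 b2) ?_ ?_
  · have := sg _ _ p34 e2
    rwa [br_negL, ← br_swap] at this
  · rwa [br_negR, ← br_swap] at p40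
  · rwa [br_negL, ← br_swap] at p14

lemma bf_neg_neg (B x u) : bf B (-x) (-u) = bf B x u := by simp [bf]

/-- The five point lemma in general position. -/
lemma BiSub.five_gen {h} (H : BiSub h) {ι : Type*} {x u : ι → ℝ × ℝ} (I : Finset ι)
    (hI : I.card = 5) (h0 : ∀ i ∈ I, (u i).1 ≠ 0)
    (hx : ∀ i ∈ I, ∀ j ∈ I, i ≠ j → br (x i) (x j) ≠ 0)
    (hu : ∀ i ∈ I, ∀ j ∈ I, i ≠ j → br (u i) (u j) ≠ 0) :
    ∃ B, ∀ i ∈ I, bf B (x i) (u i) ≤ h (x i) (u i) := by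
  classical
  wlog hpos : ∀ i ∈ I, 0 < (u i).1 generalizing x u with hw
  · obtain ⟨B, hB⟩ := @hw (fun i => if 0 < (u i).1 then x i else -x i)
      (fun i => if 0 < (u i).1 then u i else -u i)
      (by intro i hi; split_ifs <;> simpa using h0 i hi)
      (by
        intro i hi j hj hij
        have := hx i hi j hj hij
        split_ifs <;> simpa [br_negL, br_negR] using this)
      (by
        intro i hi j hj hij
        have := hu i hi j hj hij
        split_ifs <;> simpa [br_negL, br_negR] using this)
      (by
        intro i hi
        split_ifs with hh
        · exact hh
        · have := h0 i hi
          simp only [Prod.fst_neg]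
          exact neg_pos.2 (lt_of_le_of_ne (not_lt.1 hh) this))
    refine ⟨B, fun i hi => ?_⟩
    have := hB i hi
    split_ifs at this
    · exact this
    · rwa [bf_neg_neg, H.neg] at this
  set t : ι → ℝ := fun i => (u i).2 / (u i).1 with ht
  have hbr : ∀ i ∈ I, ∀ j ∈ I, br (u i) (u j) = (u i).1 * (u j).1 * (t j - t i) := by
    intro i hi j hj
    have h1 := h0 i hi
    have h2 := h0 j hj
    simp only [br, ht]; field_simp
  have inj : Set.InjOn t I := by
    intro i hi j hj hij
    by_contra hne
    apply hu i hi j hj hne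
    rw [hbr i hi j hj, hij]; simp
  have hT : (I.image t).card = 5 := by rw [Finset.card_image_of_injOn inj, hI]
  set e := (I.image t).orderEmbOfFin hT with he
  have hmem : ∀ k, ∃ i ∈ I, t i = e k := by
    intro k
    have := (I.image t).orderEmbOfFin_mem hT k
    exact Finset.mem_image.1 this
  choose c hc hce using hmem
  have G : Gen (x ∘ c) (u ∘ c) := by
    constructor
    · intro i j hij
      simp only [Function.comp]
      rw [hbr _ (hc i) _ (hc j), hce, hce]
      have h1 := hpos _ (hc i)
      have h2 := hpos _ (hc j)
      have h3 : e i < e j := e.strictMono hij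
      have h4 : 0 < e j - e i := by linarith
      positivity
    · intro i j hij
      apply hx _ (hc i) _ (hc j)
      intro h
      apply hij
      apply e.injective
      rw [← hce, ← hce, h]
  obtain ⟨B, hB⟩ := H.five G
  refine ⟨B, fun i hi => ?_⟩
  have : t i ∈ Set.range e := by
    rw [he, Finset.range_orderEmbOfFin]
    simp only [Finset.coe_image]
    exact ⟨i, hi, rfl⟩
  obtain ⟨k, hk⟩ := this
  have : i = c k := inj hi (hc k) (by rw [hce, hk])
  rw [this]
  exact hB k

lemma bf_add (B C x u) : bf (B + C) x u = bf B x u + bf C x u := by simp [bf]; ring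
lemma bf_smul (c : ℝ) (B x u) : bf (c • B) x u = c * bf B x u := by simp [bf]; ring

/-- Helly for finite families in general position. -/
lemma BiSub.finite_gen {h} (H : BiSub h) {ι : Type*} {x u : ι → ℝ × ℝ} (I : Finset ι)
    (hI : 5 ≤ I.card) (h0 : ∀ i ∈ I, (u i).1 ≠ 0)
    (hx : ∀ i ∈ I, ∀ j ∈ I, i ≠ j → br (x i) (x j) ≠ 0)
    (hu : ∀ i ∈ I, ∀ j ∈ I, i ≠ j → br (u i) (u j) ≠ 0) :
    ∃ B, ∀ i ∈ I, bf B (x i) (u i) ≤ h (x i) (u i) := by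
  have := Convex.helly_theorem (𝕜 := ℝ) (F := fun i => {B : Fin 4 → ℝ | bf B (x i) (u i) ≤ h (x i) (u i)})
    (s := I) (by simpa using hI) (by
      intro i hi B hB C hC a b ha hb hab
      simp only [Set.mem_ofPred_eq] at *
      rw [bf_add, bf_smul, bf_smul]
      calc _ ≤ a * h (x i) (u i) + b * h (x i) (u i) := by gcongr
        _ = _ := by rw [← add_mul, hab, one_mul]) (by
      intro J hJ hJc
      obtain ⟨B, hB⟩ := H.five_gen J (by simpa using hJc) (fun i hi => h0 i (hJ hi))
        (fun i hi j hj => hx i (hJ hi) j (hJ hj)) (fun i hi j hj => hu i (hJ hi) j (hJ hj))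
      exact ⟨B, by simpa using hB⟩)
  obtain ⟨B, hB⟩ := this
  exact ⟨B, by simpa using hB⟩

/-- A bound for `h`. -/
lemma BiSub.bound {h} (H : BiSub h) : ∃ C, 0 ≤ C ∧ ∀ x u : ℝ × ℝ,
    |h x u| ≤ C * (|x.1| + |x.2|) * (|u.1| + |u.2|) := by
  have one : ∀ (e f : ℝ × ℝ) (p r : ℝ), h (p • e) (r • f) ≤ (|h e f| + |h (-e) f|) * (|p| * |r|) := by
    intro e f p r
    have aux : ∀ p r : ℝ, 0 ≤ r → h (p • e) (r • f) ≤ (|h e f| + |h (-e) f|) * (|p| * |r|) := by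
      intro p r hr
      rw [H.smulR _ _ _ hr, abs_of_nonneg hr]
      rcases le_total 0 p with hp | hp
      · rw [H.smulL _ _ _ hp, abs_of_nonneg hp]
        have := le_abs_self (h e f)
        have := abs_nonneg (h (-e) f)
        calc r * (p * h e f) = h e f * (p * r) := by ring
          _ ≤ _ := by gcongr; linarith
      · rw [show p • e = (-p) • (-e) by simp, H.smulL _ _ _ (by linarith), abs_of_nonpos hp]
        have := le_abs_self (h (-e) f)
        have := abs_nonneg (h e f)
        have hp' : 0 ≤ -p := by linarith
        calc r * (-p * h (-e) f) = h (-e) f * (-p * r) := by ring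
          _ ≤ _ := by gcongr; linarith
    rcases le_total 0 r with hr | hr
    · exact aux p r hr
    · have := aux (-p) (-r) (by linarith)
      rwa [neg_smul, neg_smul, H.neg, abs_neg, abs_neg] at this
  set k : ℝ × ℝ → ℝ × ℝ → ℝ := fun e f => |h e f| + |h (-e) f| with hk
  have hk0 : ∀ e f, 0 ≤ k e f := fun e f => by positivity
  set C := k (1, 0) (1, 0) + k (1, 0) (0, 1) + k (0, 1) (1, 0) + k (0, 1) (0, 1) with hC
  have n1 := hk0 (1, 0) (1, 0)
  have n2 := hk0 (1, 0) (0, 1)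
  have n3 := hk0 (0, 1) (1, 0)
  have n4 := hk0 (0, 1) (0, 1)
  have up : ∀ x u : ℝ × ℝ, h x u ≤ C * (|x.1| + |x.2|) * (|u.1| + |u.2|) := by
    intro x u
    have ex : x = x.1 • ((1, 0) : ℝ × ℝ) + x.2 • ((0, 1) : ℝ × ℝ) := by ext <;> simp
    have eu : u = u.1 • ((1, 0) : ℝ × ℝ) + u.2 • ((0, 1) : ℝ × ℝ) := by ext <;> simp
    have h1 := H.addL (x.1 • ((1, 0) : ℝ × ℝ)) (x.2 • ((0, 1) : ℝ × ℝ)) u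
    rw [← ex] at h1
    have h2 := H.addR (x.1 • ((1, 0) : ℝ × ℝ)) (u.1 • ((1, 0) : ℝ × ℝ)) (u.2 • ((0, 1) : ℝ × ℝ))
    have h3 := H.addR (x.2 • ((0, 1) : ℝ × ℝ)) (u.1 • ((1, 0) : ℝ × ℝ)) (u.2 • ((0, 1) : ℝ × ℝ))
    rw [← eu] at h2 h3
    have m1 := one (1, 0) (1, 0) x.1 u.1
    have m2 := one (1, 0) (0, 1) x.1 u.2
    have m3 := one (0, 1) (1, 0) x.2 u.1
    have m4 := one (0, 1) (0, 1) x.2 u.2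
    calc h x u ≤ k (1, 0) (1, 0) * (|x.1| * |u.1|) + k (1, 0) (0, 1) * (|x.1| * |u.2|)
        + k (0, 1) (1, 0) * (|x.2| * |u.1|) + k (0, 1) (0, 1) * (|x.2| * |u.2|) := by
          simp only [hk]; linarith
      _ ≤ C * (|x.1| * |u.1|) + C * (|x.1| * |u.2|)
        + C * (|x.2| * |u.1|) + C * (|x.2| * |u.2|) := by
          gcongr <;> linarith
      _ = _ := by ring
  refine ⟨C, by linarith, fun x u => abs_le.2 ⟨?_, up x u⟩⟩
  have h1 := H.negsum x u
  have h2 := up (-x) u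
  simp only [Prod.fst_neg, Prod.snd_neg, abs_neg] at h2
  linarith

lemma BiSub.continuous {h} (H : BiSub h) : Continuous (fun z : (ℝ × ℝ) × (ℝ × ℝ) => h z.1 z.2) := by
  obtain ⟨C, hC, hb⟩ := H.bound
  rw [continuous_iff_continuousAt]
  intro z
  have key : ∀ y : (ℝ × ℝ) × (ℝ × ℝ), |h y.1 y.2 - h z.1 z.2| ≤
      C * (|y.1.1 - z.1.1| + |y.1.2 - z.1.2|) * (|y.2.1| + |y.2.2|)
      + C * (|z.1.1| + |z.1.2|) * (|y.2.1 - z.2.1| + |y.2.2 - z.2.2|) := by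
    intro y
    have a1 := H.addL z.1 (y.1 - z.1) y.2
    have a2 := H.addL y.1 (z.1 - y.1) y.2
    have a3 := H.addR z.1 z.2 (y.2 - z.2)
    have a4 := H.addR z.1 y.2 (z.2 - y.2)
    have b1 := (abs_le.1 (hb (y.1 - z.1) y.2)).2
    have b2 := (abs_le.1 (hb (z.1 - y.1) y.2)).2
    have b3 := (abs_le.1 (hb z.1 (y.2 - z.2))).2
    have b4 := (abs_le.1 (hb z.1 (z.2 - y.2))).2
    rw [add_sub_cancel] at a1 a2 a3 a4
    simp only [Prod.fst_sub, Prod.snd_sub] at b1 b2 b3 b4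
    rw [abs_sub_comm z.1.1, abs_sub_comm z.1.2] at b2
    rw [abs_sub_comm z.2.1, abs_sub_comm z.2.2] at b4
    rw [abs_le]
    constructor <;> linarith
  rw [ContinuousAt, tendsto_iff_norm_sub_tendsto_zero]
  refine squeeze_zero (fun _ => norm_nonneg _) key ?_
  have : Continuous fun y : (ℝ × ℝ) × (ℝ × ℝ) =>
      C * (|y.1.1 - z.1.1| + |y.1.2 - z.1.2|) * (|y.2.1| + |y.2.2|)
      + C * (|z.1.1| + |z.1.2|) * (|y.2.1 - z.2.1| + |y.2.2 - z.2.2|) := by fun_prop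
  have := this.tendsto z
  simpa using this


open Filter Topology in
lemma quad_ne {c0 c1 c2 : ℝ} (h : c0 ≠ 0 ∨ c1 ≠ 0 ∨ c2 ≠ 0) :
    ∀ᶠ ε in 𝓝[>] (0 : ℝ), c0 + c1 * ε + c2 * ε ^ 2 ≠ 0 := by
  have hpos : ∀ᶠ ε in 𝓝[>] (0 : ℝ), 0 < ε := eventually_mem_nhdsWithin
  by_cases h0 : c0 = 0
  · by_cases h1 : c1 = 0
    · have h2 : c2 ≠ 0 := by tauto
      filter_upwards [hpos] with ε he
      rw [h0, h1]; simp [h2, he.ne']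
    · have : ContinuousAt (fun ε : ℝ => c1 + c2 * ε) 0 := by fun_prop
      have := (this.eventually_ne (y := 0) (by simpa using h1)).filter_mono
        (nhdsWithin_le_nhds (s := Set.Ioi 0))
      filter_upwards [hpos, this] with ε he h3
      rw [h0, show 0 + c1 * ε + c2 * ε ^ 2 = ε * (c1 + c2 * ε) by ring]
      exact mul_ne_zero he.ne' h3
  · have : ContinuousAt (fun ε : ℝ => c0 + c1 * ε + c2 * ε ^ 2) 0 := by fun_prop
    exact (this.eventually_ne (y := 0) (by simpa using h0)).filter_mono nhdsWithin_le_nhds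

lemma frame_bound1 {C : ℝ} (hC : 0 ≤ C) (B : Fin 4 → ℝ) (x u x' u' : ℝ × ℝ)
    (hx1 : |x.1| ≤ 1) (hx2 : |x.2| ≤ 1) (hu1 : |u.1| ≤ 1) (hu2 : |u.2| ≤ 1)
    (kx1 : |x'.1 - x.1| ≤ 1 / 24) (kx2 : |x'.2 - x.2| ≤ 1 / 24)
    (ku1 : |u'.1 - u.1| ≤ 1 / 24) (ku2 : |u'.2 - u.2| ≤ 1 / 24)
    (h : bf B x' u' ≤ C * (|x'.1| + |x'.2|) * (|u'.1| + |u'.2|)) :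
    bf B x u ≤ 16 * C + (|B 0| + |B 1| + |B 2| + |B 3|) / 8 := by
  have aux : ∀ a b a' b' : ℝ, |a| ≤ 1 → |b| ≤ 1 → |a' - a| ≤ 1 / 24 → |b' - b| ≤ 1 / 24 →
      |a * b - a' * b'| ≤ 1 / 8 := by
    intro a b a' b' h1 h2 h3 h4
    have h5 : |b'| ≤ 2 := by
      have := abs_add_le (b' - b) b
      rw [sub_add_cancel] at this
      linarith
    calc |a * b - a' * b'| = |a * -(b' - b) + -(a' - a) * b'| := by ring_nf
      _ ≤ |a * -(b' - b)| + |-(a' - a) * b'| := abs_add_le _ _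
      _ = |a| * |b' - b| + |a' - a| * |b'| := by rw [abs_mul, abs_mul, abs_neg, abs_neg]
      _ ≤ 1 * (1 / 24) + 1 / 24 * 2 := by gcongr
      _ = 1 / 8 := by norm_num
  have aux2 : ∀ c a b a' b' : ℝ, |a| ≤ 1 → |b| ≤ 1 → |a' - a| ≤ 1 / 24 → |b' - b| ≤ 1 / 24 →
      c * a * b ≤ c * a' * b' + |c| / 8 := by
    intro c a b a' b' h1 h2 h3 h4
    have h5 := aux a b a' b' h1 h2 h3 h4
    have h6 := le_abs_self (c * (a * b - a' * b'))
    rw [abs_mul] at h6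
    have h7 : |c| * |a * b - a' * b'| ≤ |c| * (1 / 8) := by gcongr
    linarith
  have le2 : ∀ a a' : ℝ, |a| ≤ 1 → |a' - a| ≤ 1 / 24 → |a'| ≤ 2 := by
    intro a a' h1 h2
    have := abs_add_le (a' - a) a
    rw [sub_add_cancel] at this
    linarith
  have s1 := le2 _ _ hx1 kx1
  have s2 := le2 _ _ hx2 kx2
  have s3 := le2 _ _ hu1 ku1
  have s4 := le2 _ _ hu2 ku2
  have h8 : C * (|x'.1| + |x'.2|) * (|u'.1| + |u'.2|) ≤ C * (2 + 2) * (2 + 2) := by gcongr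
  have t1 := aux2 (B 0) _ _ _ _ hx1 hu1 kx1 ku1
  have t2 := aux2 (B 1) _ _ _ _ hx1 hu2 kx1 ku2
  have t3 := aux2 (B 2) _ _ _ _ hx2 hu1 kx2 ku1
  have t4 := aux2 (B 3) _ _ _ _ hx2 hu2 kx2 ku2
  simp only [bf] at h ⊢
  linarith

/-- The frame of eight pairs. -/
def frame : Finset ((ℝ × ℝ) × (ℝ × ℝ)) :=
  {((1, 0), (1, 0)), ((-1, 0), (1, 0)), ((1, 0), (0, 1)), ((-1, 0), (0, 1)),
    ((0, 1), (1, 0)), ((0, -1), (1, 0)), ((0, 1), (0, 1)), ((0, -1), (0, 1))}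

lemma frame_card : 5 ≤ frame.card := by
  have : frame.card = 8 := by
    unfold frame
    repeat rw [Finset.card_insert_of_notMem (by norm_num)]
    simp
  omega

lemma frame_bound {C : ℝ} (hC : 0 ≤ C) (B : Fin 4 → ℝ) (X U : (ℝ × ℝ) × (ℝ × ℝ) → ℝ × ℝ)
    (kx : ∀ z ∈ frame, |(X z).1 - z.1.1| ≤ 1 / 24 ∧ |(X z).2 - z.1.2| ≤ 1 / 24)
    (ku : ∀ z ∈ frame, |(U z).1 - z.2.1| ≤ 1 / 24 ∧ |(U z).2 - z.2.2| ≤ 1 / 24)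
    (h : ∀ z ∈ frame, bf B (X z) (U z) ≤ C * (|(X z).1| + |(X z).2|) * (|(U z).1| + |(U z).2|)) :
    B ∈ Metric.closedBall (0 : Fin 4 → ℝ) (128 * C) := by
  have main : ∀ z ∈ frame, bf B z.1 z.2 ≤ 16 * C + (|B 0| + |B 1| + |B 2| + |B 3|) / 8 := by
    intro z hz
    have hz' := hz
    have : |z.1.1| ≤ 1 ∧ |z.1.2| ≤ 1 ∧ |z.2.1| ≤ 1 ∧ |z.2.2| ≤ 1 := by
      simp only [frame, Finset.mem_insert, Finset.mem_singleton] at hz'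
      rcases hz' with rfl | rfl | rfl | rfl | rfl | rfl | rfl | rfl <;> norm_num
    obtain ⟨a1, a2, a3, a4⟩ := this
    exact frame_bound1 hC B z.1 z.2 (X z) (U z) a1 a2 a3 a4 (kx z hz).1 (kx z hz).2
      (ku z hz).1 (ku z hz).2 (h z hz)
  have m1 := main ((1, 0), (1, 0)) (by simp [frame])
  have m2 := main ((-1, 0), (1, 0)) (by simp [frame])
  have m3 := main ((1, 0), (0, 1)) (by simp [frame])
  have m4 := main ((-1, 0), (0, 1)) (by simp [frame])
  have m5 := main ((0, 1), (1, 0)) (by simp [frame])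
  have m6 := main ((0, -1), (1, 0)) (by simp [frame])
  have m7 := main ((0, 1), (0, 1)) (by simp [frame])
  have m8 := main ((0, -1), (0, 1)) (by simp [frame])
  simp [bf] at m1 m2 m3 m4 m5 m6 m7 m8
  set N := |B 0| + |B 1| + |B 2| + |B 3| with hN
  have n1 : |B 0| ≤ 16 * C + N / 8 := abs_le.2 ⟨by linarith, by linarith⟩
  have n2 : |B 1| ≤ 16 * C + N / 8 := abs_le.2 ⟨by linarith, by linarith⟩
  have n3 : |B 2| ≤ 16 * C + N / 8 := abs_le.2 ⟨by linarith, by linarith⟩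
  have n4 : |B 3| ≤ 16 * C + N / 8 := abs_le.2 ⟨by linarith, by linarith⟩
  have hN' : N ≤ 128 * C := by linarith
  rw [mem_closedBall_zero_iff, pi_norm_le_iff_of_nonneg (by positivity)]
  intro i
  rw [Real.norm_eq_abs]
  have p0 := abs_nonneg (B 0)
  have p1 := abs_nonneg (B 1)
  have p2 := abs_nonneg (B 2)
  have p3 := abs_nonneg (B 3)
  fin_cases i
  · show |B 0| ≤ _
    linarith
  · show |B 1| ≤ _
    linarith
  · show |B 2| ≤ _
    linarith
  · show |B 3| ≤ _
    linarith

lemma bf_continuous : Continuous fun q : (Fin 4 → ℝ) × (ℝ × ℝ) × (ℝ × ℝ) => bf q.1 q.2.1 q.2.2 := by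
  unfold bf; fun_prop

open Filter Topology in
/-- Finite families containing the frame. -/
lemma BiSub.finite {h} (H : BiSub h) : ∃ K : Set (Fin 4 → ℝ), IsCompact K ∧
    ∀ S : Finset ((ℝ × ℝ) × (ℝ × ℝ)), ∃ B ∈ K, ∀ z ∈ S, bf B z.1 z.2 ≤ h z.1 z.2 := by
  classical
  obtain ⟨C, hC, hb⟩ := H.bound
  refine ⟨Metric.closedBall 0 (128 * C), isCompact_closedBall _ _, fun S0 => ?_⟩
  set S := S0 ∪ frame with hS
  set a : (ℝ × ℝ) × (ℝ × ℝ) → ℝ := fun z => if hz : z ∈ S then ((S.equivFin ⟨z, hz⟩ : ℕ) : ℝ) else 0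
    with ha
  have ainj : ∀ i ∈ S, ∀ j ∈ S, i ≠ j → a i ≠ a j := by
    intro i hi j hj hij h
    simp only [ha, hi, hj, dif_pos] at h
    have h1 := Nat.cast_injective h
    have h2 := S.equivFin.injective (Fin.ext h1)
    exact hij (congrArg Subtype.val h2)
  set X : ℝ → (ℝ × ℝ) × (ℝ × ℝ) → ℝ × ℝ := fun ε z => z.1 + ε • ((1, a z) : ℝ × ℝ) with hX
  set U : ℝ → (ℝ × ℝ) × (ℝ × ℝ) → ℝ × ℝ := fun ε z => z.2 + ε • ((1, a z) : ℝ × ℝ) with hU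
  have ev : ∀ (v : (ℝ × ℝ) × (ℝ × ℝ) → ℝ × ℝ), ∀ᶠ ε in 𝓝[>] (0 : ℝ), ∀ i ∈ S, ∀ j ∈ S, i ≠ j →
      br (v i + ε • ((1, a i) : ℝ × ℝ)) (v j + ε • ((1, a j) : ℝ × ℝ)) ≠ 0 := by
    intro v
    rw [Filter.eventually_all_finset]
    intro i hi
    rw [Filter.eventually_all_finset]
    intro j hj
    by_cases hij : i = j
    · simp [hij]
    have := quad_ne (c0 := br (v i) (v j)) (c1 := br (v i) (1, a j) + br (1, a i) (v j))
      (c2 := a j - a i) (Or.inr (Or.inr (sub_ne_zero.2 (ainj i hi j hj hij).symm)))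
    filter_upwards [this] with ε he _
    convert he using 1
    simp [br]; ring
  have e0 : ∀ᶠ ε in 𝓝[>] (0 : ℝ), ∀ i ∈ S, (U ε i).1 ≠ 0 := by
    rw [Filter.eventually_all_finset]
    intro i hi
    have := quad_ne (c0 := i.2.1) (c1 := 1) (c2 := 0) (by simp)
    filter_upwards [this] with ε he
    convert he using 1
    simp [hU]
  have Xc : ∀ z, Tendsto (fun ε => X ε z) (𝓝[>] 0) (𝓝 z.1) := by
    intro z
    have : Continuous (fun ε => X ε z) := by simp only [hX]; fun_prop
    have := this.tendsto 0
    simp only [hX, zero_smul, add_zero] at this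
    exact this.mono_left nhdsWithin_le_nhds
  have Uc : ∀ z, Tendsto (fun ε => U ε z) (𝓝[>] 0) (𝓝 z.2) := by
    intro z
    have : Continuous (fun ε => U ε z) := by simp only [hU]; fun_prop
    have := this.tendsto 0
    simp only [hU, zero_smul, add_zero] at this
    exact this.mono_left nhdsWithin_le_nhds
  have close : ∀ w : ℝ × ℝ, ∀ᶠ y in 𝓝 w, |y.1 - w.1| ≤ 1 / 24 ∧ |y.2 - w.2| ≤ 1 / 24 := by
    intro w
    filter_upwards [Metric.closedBall_mem_nhds w (show (0 : ℝ) < 1 / 24 by norm_num)] with y hy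
    rw [Metric.mem_closedBall, Prod.dist_eq, max_le_iff] at hy
    exact hy
  have kx : ∀ᶠ ε in 𝓝[>] (0 : ℝ), ∀ z ∈ frame,
      |(X ε z).1 - z.1.1| ≤ 1 / 24 ∧ |(X ε z).2 - z.1.2| ≤ 1 / 24 := by
    rw [Filter.eventually_all_finset]
    exact fun z _ => (Xc z).eventually (close z.1)
  have ku : ∀ᶠ ε in 𝓝[>] (0 : ℝ), ∀ z ∈ frame,
      |(U ε z).1 - z.2.1| ≤ 1 / 24 ∧ |(U ε z).2 - z.2.2| ≤ 1 / 24 := by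
    rw [Filter.eventually_all_finset]
    exact fun z _ => (Uc z).eventually (close z.2)
  have good : ∀ᶠ ε in 𝓝[>] (0 : ℝ), ∃ B ∈ Metric.closedBall (0 : Fin 4 → ℝ) (128 * C),
      ∀ z ∈ S, bf B (X ε z) (U ε z) ≤ h (X ε z) (U ε z) := by
    filter_upwards [ev Prod.fst, ev Prod.snd, e0, kx, ku] with ε h1 h2 h3 h4 h5
    obtain ⟨B, hB⟩ := H.finite_gen (x := X ε) (u := U ε) S
      (frame_card.trans (Finset.card_le_card Finset.subset_union_right)) h3 h1 h2
    refine ⟨B, ?_, hB⟩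
    apply frame_bound hC B _ _ h4 h5
    intro z hz
    exact (hB z (Finset.mem_union_right _ hz)).trans ((le_abs_self _).trans (hb _ _))
  obtain ⟨Bf, hBf⟩ := good.choice
  set F := Ultrafilter.of (𝓝[>] (0 : ℝ)) with hF
  have hFle : (F : Filter ℝ) ≤ 𝓝[>] (0 : ℝ) := Ultrafilter.of_le _
  obtain ⟨B0, hB0, hlim⟩ := isCompact_iff_ultrafilter_le_nhds.1
    (isCompact_closedBall (0 : Fin 4 → ℝ) (128 * C)) (F.map Bf) (by
      rw [le_principal_iff]
      exact hFle (hBf.mono fun ε he => he.1))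
  refine ⟨B0, hB0, fun z hz => ?_⟩
  have hz' : z ∈ S := Finset.mem_union_left _ hz
  have tB : Tendsto Bf F (𝓝 B0) := hlim
  have tX := (Xc z).mono_left hFle
  have tU := (Uc z).mono_left hFle
  refine le_of_tendsto_of_tendsto (b := (F : Filter ℝ))
    ((bf_continuous.tendsto (B0, z.1, z.2)).comp (tB.prodMk_nhds (tX.prodMk_nhds tU)))
    ((H.continuous.tendsto (z.1, z.2)).comp (tX.prodMk_nhds tU)) ?_
  exact hFle (hBf.mono fun ε he => he.2 z hz')

/-- Every separately sublinear centrally symmetric function on `ℝ² × ℝ²` dominates a bilinear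
form. -/
theorem BiSub.exists_bilin {h} (H : BiSub h) : ∃ B, ∀ x u, bf B x u ≤ h x u := by
  obtain ⟨K, hK, hS⟩ := H.finite
  have := hK.inter_iInter_nonempty (fun z : (ℝ × ℝ) × (ℝ × ℝ) => {B | bf B z.1 z.2 ≤ h z.1 z.2})
    (fun z => isClosed_le (by unfold bf; fun_prop) continuous_const) (by
      intro S
      obtain ⟨B, hB, hB'⟩ := hS S
      exact ⟨B, hB, by simpa using hB'⟩)
  obtain ⟨B, -, hB⟩ := this
  refine ⟨B, fun x u => ?_⟩
  have := Set.mem_iInter.1 hB (x, u)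
  exact this

section Cone
variable {M : Type*} [AddCommGroup M] [Module ℝ M]

/-- The cone over a subset of the projective space, without the origin. -/
def cone (S : Set (Projectivization ℝ M)) : Set M :=
  {v | ∃ hv : v ≠ 0, Projectivization.mk ℝ v hv ∈ S}

lemma cone_ne {S : Set (Projectivization ℝ M)} {v} (h : v ∈ cone S) : v ≠ 0 := h.1

lemma cone_smul {S : Set (Projectivization ℝ M)} {v} (h : v ∈ cone S) {c : ℝ} (hc : c ≠ 0) :
    c • v ∈ cone S := by
  obtain ⟨hv, h⟩ := h
  refine ⟨smul_ne_zero hc hv, ?_⟩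
  convert h using 1
  rw [Projectivization.mk_eq_mk_iff']
  exact ⟨c, rfl⟩

lemma cone_neg {S : Set (Projectivization ℝ M)} {v} (h : v ∈ cone S) : -v ∈ cone S := by
  have := cone_smul h (c := -1) (by norm_num)
  simpa using this

lemma rep_mem_cone {S : Set (Projectivization ℝ M)} {x} : x.rep ∈ cone S ↔ x ∈ S := by
  constructor
  · rintro ⟨hv, h⟩
    rwa [Projectivization.mk_rep] at h
  · intro h
    exact ⟨x.rep_nonzero, by rwa [Projectivization.mk_rep]⟩

lemma mem_cone_iff_exists {S : Set (Projectivization ℝ M)} {v} :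
    v ∈ cone S ↔ ∃ x ∈ S, ∃ c : ℝ, c ≠ 0 ∧ v = c • x.rep := by
  constructor
  · rintro ⟨hv, h⟩
    obtain ⟨a, ha⟩ := Projectivization.exists_smul_eq_mk_rep ℝ v hv
    refine ⟨_, h, (a⁻¹ : ℝˣ), Units.ne_zero _, ?_⟩
    rw [← ha]
    change v = ((a⁻¹ : ℝˣ) : ℝ) • ((a : ℝ) • v)
    rw [smul_smul]; simp
  · rintro ⟨x, hx, c, hc, rfl⟩
    exact cone_smul (rep_mem_cone.2 hx) hc

lemma cone_convex {S : Set (Projectivization ℝ M)} (h : IsProjConvex S) :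
    ∃ φ : Module.Dual ℝ M, (∀ v ∈ cone S, φ v ≠ 0) ∧
      ∀ v ∈ cone S, ∀ v' ∈ cone S, 0 < φ v → 0 < φ v' → v + v' ∈ cone S := by
  obtain ⟨φ, -, h1, h2⟩ := h
  have h3 : ∀ v ∈ cone S, φ v ≠ 0 ∧ (φ v)⁻¹ • v ∈ projChart φ '' S := by
    intro v hv
    obtain ⟨x, hx, c, hc, rfl⟩ := mem_cone_iff_exists.1 hv
    have := h1 x hx
    refine ⟨by simp [hc, this], x, hx, ?_⟩
    simp only [projChart, map_smul, smul_eq_mul, smul_smul]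
    congr 1
    field_simp
  refine ⟨φ, fun v hv => (h3 v hv).1, fun v hv v' hv' hp hp' => ?_⟩
  have h4 := h2 (h3 v hv).2 (h3 v' hv').2 (a := φ v / (φ v + φ v')) (b := φ v' / (φ v + φ v'))
    (by positivity) (by positivity) (by field_simp)
  obtain ⟨x, hx, hxe⟩ := h4
  have h5 : v + v' = ((φ v + φ v') * (φ x.rep)⁻¹) • x.rep := by
    rw [mul_smul]
    change _ = _ • projChart φ x
    rw [hxe, smul_add, smul_smul, smul_smul, smul_smul, smul_smul]
    have e1 : (φ v + φ v') * (φ v / (φ v + φ v')) * (φ v)⁻¹ = 1 := by field_simp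
    have e2 : (φ v + φ v') * (φ v' / (φ v + φ v')) * (φ v')⁻¹ = 1 := by field_simp
    rw [e1, e2, one_smul, one_smul]
  rw [h5]
  refine cone_smul (rep_mem_cone.2 hx) (mul_ne_zero (by positivity) (inv_ne_zero (h1 x hx)))

lemma mem_cone_projImage {T : Submodule ℝ M} {A : Set (Projectivization ℝ M)} {v : M} (hv : v ∉ T) :
    T.mkQ v ∈ cone (projImage T A) ↔ ∃ t ∈ T, v + t ∈ cone A := by
  constructor
  · rintro ⟨h0, x, hx, hxT, hm⟩
    rw [Projectivization.submodule_mk, Submodule.mem_span_singleton] at hm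
    obtain ⟨c, hc⟩ := hm
    have hc0 : c ≠ 0 := by
      rintro rfl
      rw [zero_smul] at hc
      apply hxT
      rw [← Submodule.ker_mkQ T, LinearMap.mem_ker, ← hc]
    refine ⟨c⁻¹ • x.rep - v, ?_, ?_⟩
    · rw [← Submodule.ker_mkQ T, LinearMap.mem_ker, map_sub, map_smul, ← hc, smul_smul,
        inv_mul_cancel₀ hc0, one_smul, sub_self]
    · rw [add_sub_cancel]
      exact cone_smul (rep_mem_cone.2 hx) (inv_ne_zero hc0)
  · rintro ⟨t, ht, h⟩
    have h0 : T.mkQ v ≠ 0 := by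
      intro h0
      apply hv
      rwa [← Submodule.ker_mkQ T, LinearMap.mem_ker]
    obtain ⟨x, hx, c, hc, hxe⟩ := mem_cone_iff_exists.1 h
    have hq : T.mkQ v = c • T.mkQ x.rep := by
      rw [← map_smul, ← hxe, map_add]
      have : T.mkQ t = 0 := by rwa [← LinearMap.mem_ker, Submodule.ker_mkQ]
      rw [this, add_zero]
    refine ⟨h0, x, hx, ?_, ?_⟩
    · intro hxT
      have : T.mkQ x.rep = 0 := by rwa [← LinearMap.mem_ker, Submodule.ker_mkQ]
      rw [this, smul_zero] at hq
      exact h0 hq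
    · rw [Projectivization.submodule_mk, Submodule.mem_span_singleton]
      exact ⟨c⁻¹, by rw [hq, smul_smul, inv_mul_cancel₀ hc, one_smul]⟩

lemma cone_compl {S : Set (Projectivization ℝ M)} {v} (hv : v ≠ 0) : v ∈ cone Sᶜ ↔ v ∉ cone S := by
  simp [cone, hv]

lemma cone_open [TopologicalSpace M] [T1Space M] {S : Set (Projectivization ℝ M)} (hS : IsOpen S) :
    IsOpen (cone S) := by
  have h1 : Continuous (Projectivization.mk' ℝ : {v : M // v ≠ 0} → Projectivization ℝ M) :=
    continuous_quotient_mk'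
  have h2 := hS.preimage h1
  have h3 : IsOpen {v : M | v ≠ 0} := isOpen_ne
  have h4 := h3.isOpenMap_subtype_val _ h2
  convert h4 using 1
  ext v
  constructor
  · rintro ⟨hv, h⟩
    exact ⟨⟨v, hv⟩, h, rfl⟩
  · rintro ⟨⟨v, hv⟩, h, rfl⟩
    exact ⟨hv, h⟩

end Cone

lemma exists_coord (W : Submodule ℝ (Vec 3)) (hW : finrank ℝ W = 2) :
    ∃ Φ : ((ℝ × ℝ) × (ℝ × ℝ)) ≃ₗ[ℝ] Vec 3, ∀ z, Φ z ∈ W ↔ z.2 = 0 := by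
  obtain ⟨W', hc⟩ := W.exists_isCompl
  have hW' : finrank ℝ W' = 2 := by
    have := Submodule.finrank_add_eq_of_isCompl hc
    simp at this
    omega
  let e : (ℝ × ℝ) ≃ₗ[ℝ] W := LinearEquiv.ofFinrankEq _ _ (by simp [hW])
  let e' : (ℝ × ℝ) ≃ₗ[ℝ] W' := LinearEquiv.ofFinrankEq _ _ (by simp [hW'])
  refine ⟨(LinearEquiv.prodCongr e e').trans (Submodule.prodEquivOfIsCompl W W' hc), fun z => ?_⟩
  have : ((LinearEquiv.prodCongr e e').trans (Submodule.prodEquivOfIsCompl W W' hc)) z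
    = (e z.1 : Vec 3) + (e' z.2 : Vec 3) := by
    simp
  rw [this, Submodule.add_mem_iff_right _ (e z.1).2]
  constructor
  · intro h
    have h2 := (Submodule.disjoint_def.1 hc.disjoint) _ h (e' z.2).2
    have h3 : e' z.2 = 0 := Subtype.ext h2
    simpa using h3
  · intro h
    simp [h]

/-- The standard pairing on the plane. -/
def dot (x y : ℝ × ℝ) : ℝ := x.1 * y.1 + x.2 * y.2

/-- The section of the cone over `A` in coordinates. -/
def sec (Φ : ((ℝ × ℝ) × (ℝ × ℝ)) ≃ₗ[ℝ] Vec 3) (A : Set (Pt 3)) (u : ℝ × ℝ) : Set (ℝ × ℝ) :=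
  {y | Φ (y, u) ∈ cone A}

section Sections
variable {Φ : ((ℝ × ℝ) × (ℝ × ℝ)) ≃ₗ[ℝ] Vec 3} {A : Set (Pt 3)} {W : Submodule ℝ (Vec 3)}

lemma sec_smul {u y : ℝ × ℝ} (h : y ∈ sec Φ A u) {c : ℝ} (hc : c ≠ 0) : c • y ∈ sec Φ A (c • u) := by
  have := cone_smul h hc
  rw [← map_smul] at this
  exact this

lemma cone_notMem (hA : IsLConvexConcave W A) {v : Vec 3} (hv : v ∈ cone A) : v ∉ W := by
  obtain ⟨x, hx, c, hc, rfl⟩ := mem_cone_iff_exists.1 hv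
  intro h
  exact hA.2.1 x hx ((Submodule.smul_mem_iff _ hc).1 h)

lemma finrank_N (hW : finrank ℝ W = 2) (hΦ : ∀ z, Φ z ∈ W ↔ z.2 = 0) {u : ℝ × ℝ} (hu : u ≠ 0) :
    finrank ℝ (W ⊔ Submodule.span ℝ {Φ (0, u)} : Submodule ℝ (Vec 3)) = finrank ℝ W + 1 := by
  have hn : Φ (0, u) ≠ 0 := by simp [hu]
  have h1 := Submodule.finrank_sup_add_finrank_inf_eq W (Submodule.span ℝ {Φ (0, u)})
  have h2 : W ⊓ Submodule.span ℝ {Φ (0, u)} = ⊥ := by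
    rw [eq_bot_iff]
    rintro v ⟨hv1, hv2⟩
    obtain ⟨c, rfl⟩ := Submodule.mem_span_singleton.1 hv2
    have hv1 : c • Φ (0, u) ∈ W := hv1
    rw [← map_smul, hΦ] at hv1
    have : c = 0 := by simpa [hu] using hv1
    simp [this]
  rw [h2, finrank_span_singleton hn] at h1
  simpa using h1

lemma mem_N (hΦ : ∀ z, Φ z ∈ W ↔ z.2 = 0) {u y : ℝ × ℝ} {c : ℝ} :
    Φ (y, c • u) ∈ (W ⊔ Submodule.span ℝ {Φ (0, u)} : Submodule ℝ (Vec 3)) := by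
  have : Φ (y, c • u) = Φ (y, 0) + c • Φ (0, u) := by
    rw [← map_smul, ← map_add]; simp
  rw [this]
  exact Submodule.add_mem_sup ((hΦ _).2 rfl) (Submodule.smul_mem _ _ (Submodule.mem_span_singleton_self _))

lemma sec_nonempty (hW : finrank ℝ W = 2) (hΦ : ∀ z, Φ z ∈ W ↔ z.2 = 0) (hA : IsLConvexConcave W A)
    {u : ℝ × ℝ} (hu : u ≠ 0) : (sec Φ A u).Nonempty := by
  obtain ⟨x, hx, hxN⟩ := (hA.2.2.1 _ le_sup_left (finrank_N hW hΦ hu)).1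
  obtain ⟨w, hw, v, hv, hwv⟩ := Submodule.mem_sup.1 (show x.rep ∈ _ from hxN)
  obtain ⟨c, rfl⟩ := Submodule.mem_span_singleton.1 hv
  have hc : c ≠ 0 := by
    rintro rfl
    apply hA.2.1 x hx
    rw [← hwv]; simpa using hw
  obtain ⟨⟨y, u'⟩, rfl⟩ := Φ.surjective w
  have hu' : u' = 0 := (hΦ _).1 hw
  subst hu'
  have h1 : Φ (y, c • u) ∈ cone A := by
    rw [show Φ (y, c • u) = x.rep by
      rw [← hwv, ← map_smul, ← map_add]; simp]
    exact rep_mem_cone.2 hx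
  have h2 : y ∈ sec Φ A (c • u) := h1
  have h3 := sec_smul h2 (inv_ne_zero hc)
  rw [smul_smul, inv_mul_cancel₀ hc, one_smul] at h3
  exact ⟨_, h3⟩

lemma mem_cone_inter {N : Submodule ℝ (Vec 3)} {v : Vec 3} :
    v ∈ cone (A ∩ projSet N) ↔ v ∈ cone A ∧ v ∈ N := by
  constructor
  · intro h
    obtain ⟨x, hx, c, hc, rfl⟩ := mem_cone_iff_exists.1 h
    exact ⟨cone_smul (rep_mem_cone.2 hx.1) hc, N.smul_mem _ hx.2⟩
  · rintro ⟨h, hN⟩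
    obtain ⟨x, hx, c, hc, rfl⟩ := mem_cone_iff_exists.1 h
    exact cone_smul (rep_mem_cone (S := A ∩ projSet N).2
      ⟨hx, (Submodule.smul_mem_iff _ hc).1 hN⟩) hc

lemma sec_convex (hW : finrank ℝ W = 2) (hΦ : ∀ z, Φ z ∈ W ↔ z.2 = 0) (hA : IsLConvexConcave W A)
    {u : ℝ × ℝ} (hu : u ≠ 0) : Convex ℝ (sec Φ A u) := by
  obtain ⟨φ, h1, h2⟩ := cone_convex (hA.2.2.1 _ le_sup_left (finrank_N hW hΦ hu)).2
  have hN : ∀ y ∈ sec Φ A u, Φ (y, u) ∈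
      cone (A ∩ projSet (W ⊔ Submodule.span ℝ {Φ (0, u)} : Submodule ℝ (Vec 3))) := by
    intro y hy
    refine mem_cone_inter.2 ⟨hy, ?_⟩
    have := mem_N hΦ (u := u) (y := y) (c := 1)
    rwa [one_smul] at this
  have opp : ∀ y ∈ sec Φ A u, ∀ y' ∈ sec Φ A u, 0 < φ (Φ (y, u)) → φ (Φ (y', u)) < 0 → False := by
    intro y hy y' hy' hp hp'
    have := h2 _ (hN y hy) _ (cone_neg (hN y' hy')) hp (by rw [map_neg]; linarith)
    have := cone_notMem hA (mem_cone_inter.1 this).1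
    apply this
    rw [← map_neg, ← map_add, hΦ]
    simp
  rw [convex_iff_forall_pos]
  intro y hy y' hy' a b ha hb hab
  have e : Φ (a • y + b • y', u) = a • Φ (y, u) + b • Φ (y', u) := by
    rw [← map_smul, ← map_smul, ← map_add]
    congr 1
    ext1
    · simp
    · simp [← add_smul, hab]
  change Φ (a • y + b • y', u) ∈ cone A
  rw [e]
  have k := hN y hy
  have k' := hN y' hy'
  rcases lt_or_gt_of_ne (h1 _ k) with hp | hp <;> rcases lt_or_gt_of_ne (h1 _ k') with hp' | hp'
  · have := h2 _ (cone_smul k (neg_ne_zero.2 ha.ne')) _ (cone_smul k' (neg_ne_zero.2 hb.ne'))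
      (by rw [map_smul, smul_eq_mul]; nlinarith) (by rw [map_smul, smul_eq_mul]; nlinarith)
    have := cone_neg (mem_cone_inter.1 this).1
    rw [neg_smul, neg_smul, neg_add, neg_neg, neg_neg] at this
    exact this
  · exact (opp _ hy' _ hy hp' hp).elim
  · exact (opp _ hy _ hy' hp hp').elim
  · exact (mem_cone_inter.1 (h2 _ (cone_smul k ha.ne') _ (cone_smul k' hb.ne')
      (by rw [map_smul, smul_eq_mul]; positivity) (by rw [map_smul, smul_eq_mul]; positivity))).1

lemma coord_continuous : Continuous Φ := Φ.toLinearMap.continuous_of_finiteDimensional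

lemma sec_compact (hΦ : ∀ z, Φ z ∈ W ↔ z.2 = 0) (hA : IsLConvexConcave W A)
    {u : ℝ × ℝ} (hu : u ≠ 0) : IsCompact (sec Φ A u) := by
  have hO : IsOpen (cone Aᶜ) := cone_open hA.1.isOpen_compl
  have hΦc := coord_continuous (Φ := Φ)
  have hne : ∀ y, Φ (y, u) ≠ 0 := by intro y; simp [hu]
  have hcl : IsClosed (sec Φ A u) := by
    rw [← isOpen_compl_iff]
    have : (sec Φ A u)ᶜ = (fun y => Φ (y, u)) ⁻¹' (cone Aᶜ) := by
      ext y
      rw [Set.mem_preimage, cone_compl (hne y)]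
      rfl
    rw [this]
    exact hO.preimage (by fun_prop)
  have hK : IsCompact (Metric.sphere (0 : ℝ × ℝ) 1) := isCompact_sphere _ _
  have hU : IsOpen {q : (ℝ × ℝ) × ℝ | Φ (q.1, q.2 • u) ∈ cone Aᶜ} :=
    hO.preimage (f := fun q : (ℝ × ℝ) × ℝ => Φ (q.1, q.2 • u)) (by fun_prop)
  have hsub : Metric.sphere (0 : ℝ × ℝ) 1 ×ˢ {(0 : ℝ)} ⊆
      {q : (ℝ × ℝ) × ℝ | Φ (q.1, q.2 • u) ∈ cone Aᶜ} := by
    rintro ⟨y, c⟩ ⟨hy, hc⟩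
    have hc : c = 0 := hc
    have hy0 : y ≠ 0 := by
      rintro rfl
      simp at hy
    subst hc
    change Φ (y, (0 : ℝ) • u) ∈ cone Aᶜ
    rw [cone_compl (by simp [hy0])]
    intro h
    apply cone_notMem hA h
    rw [hΦ]; simp
  obtain ⟨V1, V2, hV1, hV2, hs1, hs2, hs⟩ := generalized_tube_lemma hK isCompact_singleton hU hsub
  obtain ⟨δ, hδ, hball⟩ := Metric.isOpen_iff.1 hV2 0 (hs2 rfl)
  refine (isCompact_closedBall (0 : ℝ × ℝ) (1 / δ)).of_isClosed_subset hcl ?_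
  intro y hy
  rw [mem_closedBall_zero_iff]
  by_contra hlt
  push Not at hlt
  have hpos : 0 < ‖y‖ := lt_trans (by positivity) hlt
  have h1 := sec_smul hy (inv_ne_zero hpos.ne')
  have h2 : (‖y‖⁻¹ • y, ‖y‖⁻¹) ∈ V1 ×ˢ V2 := by
    refine ⟨hs1 ?_, hball ?_⟩
    · rw [mem_sphere_zero_iff_norm, norm_smul, norm_inv, norm_norm, inv_mul_cancel₀ hpos.ne']
    · rw [mem_ball_zero_iff, norm_inv, norm_norm]
      rw [inv_lt_comm₀ hpos hδ]
      simpa using hlt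
  have h3 := hs h2
  have h4 : Φ (‖y‖⁻¹ • y, ‖y‖⁻¹ • u) ∈ cone Aᶜ := h3
  have h5 : Φ (‖y‖⁻¹ • y, ‖y‖⁻¹ • u) ∈ cone A := h1
  rw [cone_compl (cone_ne h5)] at h4
  exact h4 h5

/-- The support function of the sections. -/
def sup (Φ : ((ℝ × ℝ) × (ℝ × ℝ)) ≃ₗ[ℝ] Vec 3) (A : Set (Pt 3)) (x u : ℝ × ℝ) : ℝ :=
  open Classical in if u = 0 then 0 else sSup (dot x '' sec Φ A u)

lemma dot_continuous (x) : Continuous (dot x) := by unfold dot; fun_prop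

lemma sup_greatest (hW : finrank ℝ W = 2) (hΦ : ∀ z, Φ z ∈ W ↔ z.2 = 0) (hA : IsLConvexConcave W A)
    (x : ℝ × ℝ) {u : ℝ × ℝ} (hu : u ≠ 0) : IsGreatest (dot x '' sec Φ A u) (sup Φ A x u) := by
  rw [sup, if_neg hu]
  exact ((sec_compact hΦ hA hu).image (dot_continuous x)).isGreatest_sSup
    ((sec_nonempty hW hΦ hA hu).image _)

lemma sup_neg (hW : finrank ℝ W = 2) (hΦ : ∀ z, Φ z ∈ W ↔ z.2 = 0) (hA : IsLConvexConcave W A)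
    (x u : ℝ × ℝ) : sup Φ A (-x) (-u) = sup Φ A x u := by
  by_cases hu : u = 0
  · simp [sup, hu]
  refine (sup_greatest hW hΦ hA (-x) (neg_ne_zero.2 hu)).unique ?_
  have h := sup_greatest hW hΦ hA x hu
  obtain ⟨⟨y, hy, hye⟩, hub⟩ := h
  constructor
  · refine ⟨-y, ?_, ?_⟩
    · simpa using sec_smul hy (c := -1) (by norm_num)
    · rw [← hye]; simp [dot]
  · rintro _ ⟨z, hz, rfl⟩
    refine hub ⟨-z, ?_, ?_⟩
    · simpa using sec_smul hz (c := -1) (by norm_num)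
    · simp [dot]

lemma sup_interval (hW : finrank ℝ W = 2) (hΦ : ∀ z, Φ z ∈ W ↔ z.2 = 0)
    (hA : IsLConvexConcave W A) (x : ℝ × ℝ) {u : ℝ × ℝ} (hu : u ≠ 0) {s : ℝ}
    (h1 : - sup Φ A (-x) u ≤ s) (h2 : s ≤ sup Φ A x u) : ∃ y ∈ sec Φ A u, dot x y = s := by
  obtain ⟨⟨y, hy, hye⟩, -⟩ := sup_greatest hW hΦ hA x hu
  obtain ⟨⟨z, hz, hze⟩, -⟩ := sup_greatest hW hΦ hA (-x) hu
  have hze' : dot x z = - sup Φ A (-x) u := by rw [← hze]; simp [dot]; ring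
  have := (sec_convex hW hΦ hA hu).isPreconnected.intermediate_value hz hy
    (dot_continuous x).continuousOn
  have hs : s ∈ Icc (dot x z) (dot x y) := ⟨by rw [hze']; exact h1, by rw [hye]; exact h2⟩
  obtain ⟨w, hw, hwe⟩ := this hs
  exact ⟨w, hw, hwe⟩

lemma sup_zeroL (hW : finrank ℝ W = 2) (hΦ : ∀ z, Φ z ∈ W ↔ z.2 = 0)
    (hA : IsLConvexConcave W A) (u : ℝ × ℝ) : sup Φ A 0 u = 0 := by
  by_cases hu : u = 0
  · simp [sup, hu]
  obtain ⟨⟨y, hy, hye⟩, -⟩ := sup_greatest hW hΦ hA 0 hu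
  rw [← hye]; simp [dot]

lemma sup_addR (hW : finrank ℝ W = 2) (hΦ : ∀ z, Φ z ∈ W ↔ z.2 = 0)
    (hA : IsLConvexConcave W A) (x u u' : ℝ × ℝ) :
    sup Φ A x (u + u') ≤ sup Φ A x u + sup Φ A x u' := by
  by_cases hx : x = 0
  · subst hx; simp [sup_zeroL hW hΦ hA]
  have hxx : 0 < dot x x := by
    obtain ⟨a, b⟩ := x
    have : a ≠ 0 ∨ b ≠ 0 := by
      by_contra hh; push Not at hh; exact hx (by simp [hh.1, hh.2])
    simp only [dot]
    rcases this with h | h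
    · nlinarith [mul_self_pos.2 h, mul_self_nonneg b]
    · nlinarith [mul_self_pos.2 h, mul_self_nonneg a]
  set j : ℝ × ℝ := (-x.2, x.1) with hj
  have hj0 : j ≠ 0 := by
    intro h
    apply hx
    have h1 : -x.2 = 0 := congrArg Prod.fst h
    have h2 : x.1 = 0 := congrArg Prod.snd h
    ext
    · exact h2
    · simpa using h1
  have hjker : ∀ y, dot x y = 0 → ∃ c : ℝ, y = c • j := by
    intro y hy
    refine ⟨br x y / dot x x, ?_⟩
    simp only [dot] at hy
    ext
    · simp only [hj, Prod.smul_fst, smul_eq_mul]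
      field_simp
      simp only [dot, br]
      linear_combination x.1 * hy
    · simp only [hj, Prod.smul_snd, smul_eq_mul]
      field_simp
      simp only [dot, br]
      linear_combination x.2 * hy
  have hxj : dot x j = 0 := by simp [dot, hj]; ring
  have dot_add : ∀ y z, dot x (y + z) = dot x y + dot x z := by intro y z; simp [dot]; ring
  have dot_smul : ∀ (c : ℝ) y, dot x (c • y) = c * dot x y := by intro c y; simp [dot]; ring
  set T : Submodule ℝ (Vec 3) := Submodule.span ℝ {Φ (j, 0)} with hT
  have hTW : T ≤ W := by
    rw [hT, Submodule.span_singleton_le_iff_mem, hΦ]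
  have memT : ∀ z, Φ z ∈ T ↔ z.2 = 0 ∧ dot x z.1 = 0 := by
    rintro ⟨y, v⟩
    rw [hT, Submodule.mem_span_singleton]
    constructor
    · rintro ⟨c, hc⟩
      rw [← map_smul] at hc
      have := Φ.injective hc
      simp only [Prod.smul_mk, smul_zero, Prod.mk.injEq] at this
      refine ⟨this.2.symm, ?_⟩
      rw [← this.1, dot_smul, hxj, mul_zero]
    · rintro ⟨h1, h2⟩
      obtain ⟨c, hc⟩ := hjker y h2
      refine ⟨c, ?_⟩
      dsimp only at h1
      rw [← map_smul, hc, h1]; simp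
  obtain ⟨φ, hφ1, hφ2⟩ := cone_convex (hA.2.2.2 T hTW (by
    rw [hW, hT, finrank_span_singleton (by simp [hj0])])).2
  -- membership in the complement
  have memC : ∀ z, Φ z ∉ T → (T.mkQ (Φ z) ∈ cone (projImage T A)ᶜ ↔
      ∀ y, dot x y = dot x z.1 → y ∉ sec Φ A z.2) := by
    intro z hz
    have hne : T.mkQ (Φ z) ≠ 0 := by
      intro h0
      apply hz
      rwa [← Submodule.ker_mkQ T, LinearMap.mem_ker]
    rw [cone_compl hne, mem_cone_projImage hz]
    constructor
    · intro h y hy hys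
      apply h
      refine ⟨Φ (y - z.1, 0), (memT _).2 ⟨rfl, ?_⟩, ?_⟩
      · have := dot_add (y - z.1) z.1
        rw [sub_add_cancel] at this
        dsimp only; linarith
      · rw [← map_add]
        have : z + (y - z.1, 0) = (y, z.2) := by ext1 <;> simp
        rw [this]; exact hys
    · rintro h ⟨t, ht, hc⟩
      obtain ⟨⟨y, v⟩, rfl⟩ := Φ.surjective t
      obtain ⟨h1, h2⟩ := (memT _).1 ht
      dsimp only at h1 h2
      subst h1
      refine h (z.1 + y) (by rw [dot_add, h2, add_zero]) ?_
      rw [← map_add] at hc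
      have : z + (y, 0) = (z.1 + y, z.2) := by ext1 <;> simp
      rw [this] at hc
      exact hc
  -- the upper part `K`
  have hKT : ∀ z : (ℝ × ℝ) × (ℝ × ℝ), sup Φ A x z.2 < dot x z.1 → Φ z ∉ T := by
    intro z hz h
    obtain ⟨h1, h2⟩ := (memT _).1 h
    rw [h1, h2, sup, if_pos rfl] at hz
    exact lt_irrefl _ hz
  have hsecW : ∀ y, y ∉ sec Φ A 0 := by
    intro y hy
    exact cone_notMem hA hy ((hΦ _).2 rfl)
  have hKC : ∀ z : (ℝ × ℝ) × (ℝ × ℝ), sup Φ A x z.2 < dot x z.1 →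
      T.mkQ (Φ z) ∈ cone (projImage T A)ᶜ := by
    intro z hz
    rw [memC z (hKT z hz)]
    intro y hy hys
    by_cases hz2 : z.2 = 0
    · rw [hz2] at hys
      exact hsecW _ hys
    · have := (sup_greatest hW hΦ hA x hz2).2 ⟨y, hys, rfl⟩
      linarith
  set ψ : (ℝ × ℝ) × (ℝ × ℝ) → ℝ := fun z => φ (T.mkQ (Φ z)) with hψ
  have ψadd : ∀ z z', ψ (z + z') = ψ z + ψ z' := by intro z z'; simp only [hψ, map_add]
  have ψsmul : ∀ (c : ℝ) z, ψ (c • z) = c * ψ z := by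
    intro c z; simp only [hψ, map_smul, smul_eq_mul]
  have hKne : ∀ z : (ℝ × ℝ) × (ℝ × ℝ), sup Φ A x z.2 < dot x z.1 → ψ z ≠ 0 :=
    fun z hz => hφ1 _ (hKC z hz)
  set e : (ℝ × ℝ) × (ℝ × ℝ) := (x, 0) with he
  have heK : sup Φ A x e.2 < dot x e.1 := by simp [he, sup, hxx]
  have sign : ∀ z : (ℝ × ℝ) × (ℝ × ℝ), sup Φ A x z.2 < dot x z.1 → 0 < ψ z * ψ e := by
    intro z hz
    by_contra hneg
    push Not at hneg
    have h0 := hKne e heK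
    have hc : 0 ≤ - ψ z / ψ e := by
      rw [show - ψ z / ψ e = -(ψ z * ψ e) * (ψ e)⁻¹ ^ 2 by field_simp]
      have : 0 ≤ -(ψ z * ψ e) := by linarith
      positivity
    apply hKne (z + (- ψ z / ψ e) • e)
    · simp only [he, Prod.snd_add, Prod.fst_add, Prod.smul_snd, Prod.smul_fst, smul_zero, add_zero]
      rw [dot_add, dot_smul]
      have := mul_nonneg hc hxx.le
      linarith
    · rw [ψadd, ψsmul]; field_simp; ring
  -- sums of elements of `K`
  have sumK : ∀ z z' : (ℝ × ℝ) × (ℝ × ℝ), sup Φ A x z.2 < dot x z.1 → sup Φ A x z'.2 < dot x z'.1 →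
      T.mkQ (Φ (z + z')) ∈ cone (projImage T A)ᶜ := by
    intro z z' hz hz'
    have s1 := sign z hz
    have s2 := sign z' hz'
    rcases lt_or_gt_of_ne (hKne e heK) with h0 | h0
    · have n1 : 0 < φ (-T.mkQ (Φ z)) := by
        rw [map_neg]; change 0 < -ψ z; nlinarith
      have n2 : 0 < φ (-T.mkQ (Φ z')) := by
        rw [map_neg]; change 0 < -ψ z'; nlinarith
      have := cone_neg (hφ2 _ (cone_neg (hKC z hz)) _ (cone_neg (hKC z' hz')) n1 n2)
      rw [neg_add, neg_neg, neg_neg] at this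
      rwa [map_add, map_add]
    · have n1 : 0 < φ (T.mkQ (Φ z)) := by
        change 0 < ψ z; nlinarith
      have n2 : 0 < φ (T.mkQ (Φ z')) := by
        change 0 < ψ z'; nlinarith
      have := hφ2 _ (hKC z hz) _ (hKC z' hz') n1 n2
      rwa [map_add, map_add]
  have concl : ∀ z z' : (ℝ × ℝ) × (ℝ × ℝ), sup Φ A x z.2 < dot x z.1 →
      sup Φ A x z'.2 < dot x z'.1 → sup Φ A x (z + z').2 ≤ dot x (z + z').1 := by
    intro z z' hz hz'
    have hC := sumK z z' hz hz'
    have hψpos : 0 < ψ (z + z') * ψ e := by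
      rw [ψadd, add_mul]; exact add_pos (sign z hz) (sign z' hz')
    set s := z + z' with hs
    have hsT : Φ s ∉ T := by
      intro h
      apply cone_ne hC
      rwa [← LinearMap.mem_ker, Submodule.ker_mkQ]
    rw [memC s hsT] at hC
    have hlow : ¬ (dot x s.1 < - sup Φ A (-x) s.2) := by
      intro hlt
      have h1 : sup Φ A x (-s).2 < dot x (-s).1 := by
        have e1 : sup Φ A x (-s.2) = sup Φ A (-x) s.2 := by
          have := sup_neg hW hΦ hA (-x) s.2
          rwa [neg_neg] at this
        have e2 : dot x (-s.1) = - dot x s.1 := by simp [dot]; ring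
        rw [Prod.snd_neg, Prod.fst_neg, e1, e2]
        linarith
      have h2 := sign _ h1
      have h3 : ψ (-s) = - ψ s := by
        have := ψsmul (-1) s
        simpa using this
      rw [h3] at h2
      linarith
    push Not at hlow
    by_cases hs0 : s.2 = 0
    · rw [hs0, sup, if_pos rfl, neg_zero] at hlow
      rw [hs0, sup, if_pos rfl]
      exact hlow
    · by_contra hlt
      push Not at hlt
      obtain ⟨y, hy, hye⟩ := sup_interval hW hΦ hA x hs0 hlow hlt.le
      exact hC y hye hy
  apply le_of_forall_pos_le_add
  intro δ hδ
  have pt : ∀ v : ℝ × ℝ, ∃ y, dot x y = sup Φ A x v + δ / 2 := by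
    intro v
    refine ⟨((sup Φ A x v + δ / 2) / dot x x) • x, ?_⟩
    rw [dot_smul]; field_simp
  obtain ⟨y, hy⟩ := pt u
  obtain ⟨y', hy'⟩ := pt u'
  have := concl (y, u) (y', u') (by dsimp only; linarith) (by dsimp only; linarith)
  simp only [Prod.mk_add_mk, dot_add] at this
  linarith

lemma sup_bisub (hW : finrank ℝ W = 2) (hΦ : ∀ z, Φ z ∈ W ↔ z.2 = 0)
    (hA : IsLConvexConcave W A) : BiSub (sup Φ A) where
  addL x y u := by
    by_cases hu : u = 0
    · simp [sup, hu]
    obtain ⟨⟨z, hz, hze⟩, -⟩ := sup_greatest hW hΦ hA (x + y) hu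
    have h1 := (sup_greatest hW hΦ hA x hu).2 ⟨z, hz, rfl⟩
    have h2 := (sup_greatest hW hΦ hA y hu).2 ⟨z, hz, rfl⟩
    rw [← hze]
    have : dot (x + y) z = dot x z + dot y z := by simp [dot]; ring
    linarith
  addR := sup_addR hW hΦ hA
  smulL c x u hc := by
    by_cases hu : u = 0
    · simp [sup, hu]
    obtain ⟨⟨z, hz, hze⟩, hub⟩ := sup_greatest hW hΦ hA x hu
    have hd : ∀ y, dot (c • x) y = c * dot x y := by intro y; simp [dot]; ring
    refine (sup_greatest hW hΦ hA (c • x) hu).unique ⟨⟨z, hz, by rw [hd, hze]⟩, ?_⟩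
    rintro _ ⟨y, hy, rfl⟩
    rw [hd]
    exact mul_le_mul_of_nonneg_left (hub ⟨y, hy, rfl⟩) hc
  smulR c x u hc := by
    by_cases hu : u = 0
    · simp [sup, hu]
    rcases hc.eq_or_lt with rfl | hc
    · simp [sup]
    obtain ⟨⟨z, hz, hze⟩, hub⟩ := sup_greatest hW hΦ hA x hu
    have hd : ∀ (c : ℝ) y, dot x (c • y) = c * dot x y := by intro c y; simp [dot]; ring
    refine (sup_greatest hW hΦ hA x (smul_ne_zero hc.ne' hu)).unique
      ⟨⟨c • z, sec_smul hz hc.ne', by rw [hd, hze]⟩, ?_⟩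
    rintro _ ⟨y, hy, rfl⟩
    have h1 := sec_smul hy (inv_ne_zero hc.ne')
    rw [smul_smul, inv_mul_cancel₀ hc.ne', one_smul] at h1
    have h2 := hub ⟨_, h1, rfl⟩
    rw [hd] at h2
    rwa [inv_mul_le_iff₀ hc] at h2
  neg := sup_neg hW hΦ hA

end Sections

/-- Any `L`-convex-concave subset of `ℝP³`, where `L` is a projective
line, contains a projective line.  (The Main Hypothesis in dimension three.) -/
theorem statement19 (W : Submodule ℝ (Vec 3)) (hW : finrank ℝ W = 2)
    (A : Set (Pt 3)) (hA : IsLConvexConcave W A) :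
    ∃ M : Submodule ℝ (Vec 3), finrank ℝ M = 2 ∧ projSet M ⊆ A := by
  obtain ⟨Φ, hΦ⟩ := exists_coord W hW
  obtain ⟨B, hB⟩ := (sup_bisub hW hΦ hA).exists_bilin
  let F : (ℝ × ℝ) →ₗ[ℝ] (ℝ × ℝ) :=
    { toFun := fun u => (B 0 * u.1 + B 1 * u.2, B 2 * u.1 + B 3 * u.2)
      map_add' := by intro u v; ext <;> simp <;> ring
      map_smul' := by intro c v; ext <;> simp <;> ring }
  have hF : ∀ x u, dot x (F u) = bf B x u := by
    intro x u
    simp only [F, LinearMap.coe_mk, AddHom.coe_mk, dot, bf]; ring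
  have hmem : ∀ u, u ≠ 0 → F u ∈ sec Φ A u := by
    intro u hu
    by_contra hn
    obtain ⟨f, s, h1, h2⟩ := geometric_hahn_banach_closed_point (sec_convex hW hΦ hA hu)
      (sec_compact hΦ hA hu).isClosed hn
    have hf : ∀ y, f y = dot (f (1, 0), f (0, 1)) y := by
      intro y
      have ey : y = y.1 • ((1, 0) : ℝ × ℝ) + y.2 • ((0, 1) : ℝ × ℝ) := by ext <;> simp
      conv_lhs => rw [ey, map_add, map_smul, map_smul]
      simp only [dot, smul_eq_mul]; ring
    obtain ⟨⟨y, hy, hye⟩, -⟩ := sup_greatest hW hΦ hA (f (1, 0), f (0, 1)) hu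
    have h3 := h1 y hy
    have h4 := hB (f (1, 0), f (0, 1)) u
    rw [← hF, ← hf, ← hye, ← hf] at h4
    linarith
  let G : (ℝ × ℝ) →ₗ[ℝ] Vec 3 := Φ.toLinearMap ∘ₗ (F.prod LinearMap.id)
  have hG : ∀ u, G u = Φ (F u, u) := fun u => rfl
  have hGi : Function.Injective G := by
    intro u v huv
    rw [hG, hG] at huv
    exact congrArg Prod.snd (Φ.injective huv)
  refine ⟨LinearMap.range G, ?_, ?_⟩
  · rw [LinearMap.finrank_range_of_inj hGi]; simp
  · intro x hx
    obtain ⟨u, hu⟩ := (show x.rep ∈ LinearMap.range G from hx)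
    have hu0 : u ≠ 0 := by
      rintro rfl
      rw [map_zero] at hu
      exact x.rep_nonzero hu.symm
    apply rep_mem_cone.1
    rw [← hu, hG]
    exact hmem u hu0

end CC
end
end
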